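/- Let K = ℚ(√-5), let a = √-5 ∈ K, and let σ be the nontrivial automorphism of K over ℚ. In K(t)[x], set f_A(t,x) = 5^3·(24a·x^2 + 16a·x - 648a - x^4 - 60x^3 - 870x^2 - 220x + 6399)^3 - 2^12·3^15·(118a - 475)·t·x^2, and let f_{A2}(t,x) = f_A(t,x)·(σf_A)(t,x), a polynomial with coefficients in ℚ(t). Then the degree 48 polynomial f_{A2}(t, y^2) ∈ ℚ(t)[y], obtained by substituting y^2 for x, has Galois group over ℚ(t) of cardinality 760320 (a group of shape 2^2.M₁₂.2). -/

import Mathlib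

open Polynomial

set_option linter.unusedSectionVars false

namespace M12

section Lists

/-- The value at `α` of the polynomial with coefficient list `l`. -/
def evalList {R : Type*} [CommRing R] (α : R) : List ℕ → R
  | [] => 0
  | c :: l => c + α * evalList α l

/-- Multiplication by `X` modulo `p` and modulo `X ^ n - m`, where `n` is the length of `m`. -/
def mulX (p : ℕ) (m v : List ℕ) : List ℕ :=
  List.zipWith (fun c d => (c + v.getLastD 0 * d) % p) (0 :: v) m

/-- Multiplication modulo `p` and modulo `X ^ n - m`. -/
def mulMod (p : ℕ) (m u v : List ℕ) : List ℕ :=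
  u.foldr (fun c r => List.zipWith (fun d e => (c * d + e) % p) v (mulX p m r))
    (List.replicate m.length 0)

/-- The `n`-th power modulo `p` and modulo `X ^ n - m`, for `n < 2 ^ k`. -/
def powMod (p : ℕ) (m v : List ℕ) : ℕ → ℕ → List ℕ
  | 0, _ => 1 :: List.replicate (m.length - 1) 0
  | k + 1, n =>
    let h := powMod p m v k (n / 2)
    if n % 2 = 1 then mulMod p m (mulMod p m h h) v else mulMod p m h h

/-- The power `X ^ (p ^ k)` modulo `p` and modulo `X ^ n - m`, for `p < 64`. -/
def frob (p : ℕ) (m : List ℕ) (k : ℕ) : List ℕ :=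
  (fun v => powMod p m v 6 p)^[k] (0 :: 1 :: List.replicate (m.length - 2) 0)

variable {R : Type*} [CommRing R] {p : ℕ} [CharP R p] {α : R} {m : List ℕ}

variable (R p) in
theorem cast_mod (n : ℕ) : ((n % p : ℕ) : R) = n := by
  rw [CharP.cast_eq_iff_mod_eq R p]
  exact Nat.mod_mod _ _

theorem evalList_replicate (α : R) (n : ℕ) : evalList α (List.replicate n 0) = 0 := by
  induction n with
  | zero => rfl
  | succ n ih => simp [List.replicate_succ, evalList, ih]

theorem evalList_zipWith_shift (k : ℕ) (m v : List ℕ) (c : ℕ) (h : v.length = m.length) :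
    evalList α (List.zipWith (fun c d => (c + k * d) % p) (c :: v) m) =
      evalList α (c :: v) - α ^ m.length * (v.getLastD c : ℕ) + k * evalList α m := by
  induction m generalizing v c with
  | nil =>
    obtain rfl : v = [] := by simpa using h
    simp [evalList]
  | cons d m ih =>
    obtain ⟨b, v, rfl⟩ := List.exists_cons_of_length_eq_add_one (l := v) (n := m.length)
        (by simpa using h)
    have := ih v b (by simpa using h)
    rw [List.zipWith_cons_cons, evalList, this, cast_mod R p]
    simp only [evalList, List.getLastD_cons, List.length_cons]
    push_cast
    ring

theorem length_mulX {v : List ℕ} (h : v.length = m.length) : (mulX p m v).length = m.length := by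
  simp [mulX, h]

theorem evalList_mulX (hm : evalList α m = α ^ m.length) {v : List ℕ} (h : v.length = m.length) :
    evalList α (mulX p m v) = α * evalList α v := by
  rw [mulX, evalList_zipWith_shift _ _ _ _ h, hm]
  simp only [evalList]
  push_cast
  ring

theorem evalList_zipWith (c : ℕ) (u v : List ℕ) (h : u.length = v.length) :
    evalList α (List.zipWith (fun d e => (c * d + e) % p) u v) =
      c * evalList α u + evalList α v := by
  induction u generalizing v with
  | nil =>
    obtain rfl : v = [] := by simpa using h.symm
    simp [evalList]
  | cons d u ih =>
    obtain ⟨b, v, rfl⟩ := List.exists_cons_of_length_eq_add_one (l := v) (n := u.length)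
        (by simpa using h.symm)
    rw [List.zipWith_cons_cons, evalList, ih v (by simpa using h), cast_mod R p]
    simp only [evalList]
    push_cast
    ring

theorem mulMod_spec (hm : evalList α m = α ^ m.length) (u : List ℕ) {v : List ℕ}
    (h : v.length = m.length) : (mulMod p m u v).length = m.length ∧
      evalList α (mulMod p m u v) = evalList α u * evalList α v := by
  induction u with
  | nil => simp [mulMod, evalList_replicate, evalList]
  | cons c u ih =>
    have e : mulMod p m (c :: u) v =
      List.zipWith (fun d e => (c * d + e) % p) v (mulX p m (mulMod p m u v)) := rfl
    have l := length_mulX (p := p) ih.1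
    refine ⟨by simp [e, l, h], ?_⟩
    rw [e, evalList_zipWith _ _ _ (by rw [h, l]), evalList_mulX hm ih.1, ih.2]
    simp only [evalList]
    ring

theorem powMod_spec (hm : evalList α m = α ^ m.length) (h0 : m ≠ []) {v : List ℕ}
    (h : v.length = m.length) (k n : ℕ) (hn : n < 2 ^ k) :
    (powMod p m v k n).length = m.length ∧
      evalList α (powMod p m v k n) = evalList α v ^ n := by
  induction k generalizing n with
  | zero =>
    obtain rfl : n = 0 := by simpa using hn
    have := List.length_pos_iff.2 h0
    simp only [powMod, evalList, evalList_replicate, List.length_cons, List.length_replicate]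
    exact ⟨by omega, by simp⟩
  | succ k ih =>
    obtain ⟨h1, h2⟩ := ih (n / 2) (by rw [pow_succ] at hn; omega)
    obtain ⟨h3, h4⟩ := mulMod_spec (p := p) hm (powMod p m v k (n / 2)) h1
    obtain ⟨h5, h6⟩ := mulMod_spec (p := p) hm
      (mulMod p m (powMod p m v k (n / 2)) (powMod p m v k (n / 2))) h
    rw [h2, ← pow_add] at h4
    rw [powMod]
    split_ifs with hn'
    · refine ⟨h5, h6.trans ?_⟩
      rw [h4, ← pow_succ]
      congr 1
      omega
    · refine ⟨h3, h4.trans ?_⟩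
      congr 1
      omega

theorem evalList_frob (hp : p < 64) (hm : evalList α m = α ^ m.length) (h2 : 2 ≤ m.length)
    (k : ℕ) : evalList α (frob p m k) = α ^ p ^ k := by
  suffices (frob p m k).length = m.length ∧ evalList α (frob p m k) = α ^ p ^ k from this.2
  induction k with
  | zero =>
    simp only [frob, Function.iterate_zero, id, evalList, evalList_replicate, List.length_cons,
      List.length_replicate]
    exact ⟨by omega, by simp⟩
  | succ k ih =>
    have e : frob p m (k + 1) = powMod p m (frob p m k) 6 p := Function.iterate_succ_apply' _ _ _
    have := powMod_spec (p := p) hm (by rintro rfl; simp at h2) ih.1 6 p (by simpa using hp)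
    rw [e]
    refine ⟨this.1, this.2.trans ?_⟩
    rw [ih.2, ← pow_mul, pow_succ]

end Lists

section Polys

variable {R : Type*} [CommRing R]

/-- The quartic polynomial whose cube is the specialization of `dodecic` at `t = 0`. -/
def quartic (a x : R) : R :=
  x ^ 4 + 300 * x ^ 3 + 25 * (870 - 24 * a) * x ^ 2 + 125 * (220 - 16 * a) * x
    - 625 * (6399 - 648 * a)

/-- The monic integral form of the polynomial `f_A`; see `dodecic_five_mul`. -/
def dodecic (a t x : R) : R :=
  quartic a x ^ 3 + 5 ^ 7 * 2 ^ 12 * 3 ^ 15 * (118 * a - 475) * t * x ^ 2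

theorem map_dodecic {R' F : Type*} [CommRing R'] [FunLike F R R'] [RingHomClass F R R'] (f : F)
    (a t x : R) : f (dodecic a t x) = dodecic (f a) (f t) (f x) := by
  simp only [dodecic, quartic, map_add, map_sub, map_mul, map_pow, map_ofNat]

/-- The polynomial `X ^ 12 - dodecic a t X` modulo `p`, as a list of coefficients. -/
def tail (p a t : ℕ) : List ℕ :=
  let B : ℤ := 25 * (870 - 24 * a)
  let C : ℤ := 125 * (220 - 16 * a)
  let D : ℤ := -625 * (6399 - 648 * a)
  let E : ℤ := 5 ^ 7 * 2 ^ 12 * 3 ^ 15 * (118 * a - 475) * t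
  [D ^ 3, 3 * C * D ^ 2, 3 * B * D ^ 2 + 3 * C ^ 2 * D + E,
    900 * D ^ 2 + 6 * B * C * D + C ^ 3,
    3 * D ^ 2 + 1800 * C * D + 3 * B ^ 2 * D + 3 * B * C ^ 2,
    6 * C * D + 1800 * B * D + 900 * C ^ 2 + 3 * B ^ 2 * C,
    6 * B * D + 270000 * D + 3 * C ^ 2 + 1800 * B * C + B ^ 3,
    1800 * D + 6 * B * C + 270000 * C + 900 * B ^ 2,
    3 * D + 1800 * C + 3 * B ^ 2 + 270000 * B,
    3 * C + 1800 * B + 27000000, 3 * B + 270000, 900].map fun c => (-c % p).toNat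

theorem length_tail (p a t : ℕ) : (tail p a t).length = 12 := rfl

theorem cast_emod_toNat (p : ℕ) [NeZero p] [CharP R p] (c : ℤ) : (((c % p).toNat : ℕ) : R) = c := by
  have h : (((c % p).toNat : ℕ) : ℤ) = c % p :=
    Int.toNat_of_nonneg (Int.emod_nonneg _ (by exact_mod_cast NeZero.ne p))
  rw [← Int.cast_natCast, h, CharP.intCast_eq_intCast R p]
  exact Int.mod_modEq _ _

theorem evalList_tail (p a t : ℕ) [NeZero p] [CharP R p] (α : R) (h : dodecic (a : R) t α = 0) :
    evalList α (tail p a t) = α ^ 12 := by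
  rw [← sub_eq_zero, ← neg_eq_zero, ← h]
  simp only [tail, evalList, List.map_cons, List.map_nil, cast_emod_toNat, dodecic, quartic]
  push_cast
  ring

end Polys

section Reduction

variable {S Γ : Type*} [CommRing S] [IsDomain S] [Algebra ℤ[X] S] [FaithfulSMul ℤ[X] S]
  [Group Γ] [Finite Γ] [MulSemiringAction Γ S] [SMulCommClass Γ ℤ[X] S]
  [Algebra.IsInvariant ℤ[X] S Γ]

variable (S Γ) in
attribute [local instance] Ideal.Quotient.field in
/-- Specializing at `t = t₀` and reducing modulo `p` extends to `S`, and some element of `Γ`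
induces the Frobenius. -/
theorem exists_frobenius (p : ℕ) [Fact p.Prime] (t₀ : ℕ) :
    ∃ (ψ : S →+* AlgebraicClosure (ZMod p)) (g : Γ), ψ (algebraMap ℤ[X] S X) = t₀ ∧
      ∀ s, ψ (g • s) = ψ s ^ p := by
  have hint : Algebra.IsIntegral ℤ[X] S := Algebra.IsInvariant.isIntegral ℤ[X] S Γ
  let φ : ℤ[X] →+* ZMod p := eval₂RingHom (Int.castRingHom _) t₀
  have hφ : Function.Surjective φ := ZMod.ringHom_surjective φ
  let P : Ideal ℤ[X] := RingHom.ker φ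
  have hPm : P.IsMaximal := RingHom.ker_isMaximal_of_surjective φ hφ
  obtain ⟨Q, hQ, hQP⟩ := Ideal.exists_ideal_over_prime_of_isIntegral_of_isDomain (S := S) P
    (by rw [(RingHom.injective_iff_ker_eq_bot _).1 (FaithfulSMul.algebraMap_injective ℤ[X] S)]
        exact bot_le)
  have hlo : Q.LiesOver P := ⟨hQP.symm⟩
  have hQm : Q.IsMaximal := Ideal.IsMaximal.of_liesOver_isMaximal Q P
  let e : ℤ[X] ⧸ P ≃+* ZMod p := RingHom.quotientKerEquivOfSurjective hφ
  have : Finite (ℤ[X] ⧸ P) := Finite.of_equiv _ e.symm.toEquiv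
  have hcard : Nat.card (ℤ[X] ⧸ P) = p := by
    rw [Nat.card_congr e.toEquiv, Nat.card_zmod]
  have := Ideal.Quotient.finite_of_isInvariant Γ P Q
  have : Finite (S ⧸ Q) := Module.finite_of_finite (ℤ[X] ⧸ P)
  obtain ⟨g, hg⟩ := IsArithFrobAt.exists_of_isInvariant ℤ[X] Γ Q
  have hmem : ∀ f : ℤ[X], φ f = 0 → algebraMap ℤ[X] S f ∈ Q := fun f hf => by
    have : f ∈ Q.comap (algebraMap ℤ[X] S) := by rw [hQP]; exact hf
    exact this
  have hp0 : (p : S ⧸ Q) = 0 := by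
    have := Ideal.Quotient.eq_zero_iff_mem.2 (hmem p (by simp))
    simpa using this
  have : CharP (S ⧸ Q) p := (CharP.charP_iff_prime_eq_zero Fact.out).2 hp0
  let : Algebra (ZMod p) (S ⧸ Q) := ZMod.algebra _ p
  let θ : S ⧸ Q →ₐ[ZMod p] AlgebraicClosure (ZMod p) := IsAlgClosed.lift
  refine ⟨θ.toRingHom.comp (Ideal.Quotient.mk Q), g, ?_, fun s => ?_⟩
  · have := Ideal.Quotient.eq_zero_iff_mem.2 (hmem (X - C (t₀ : ℤ)) (by simp [φ]))
    rw [map_sub, map_sub, sub_eq_zero] at this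
    have h2 := congrArg θ this
    simpa using h2
  · have h1 := hg s
    have h2 : Q.under ℤ[X] = P := hQP
    rw [h2, hcard] at h1
    have h3 := Ideal.Quotient.eq.2 h1
    have h4 := congrArg θ h3
    simpa using h4

theorem exists_nat_of_pow_eq {p : ℕ} [Fact p.Prime] {α : AlgebraicClosure (ZMod p)}
    (h : α ^ p = α) : ∃ n < p, α = (n : AlgebraicClosure (ZMod p)) := by
  have h1 := (Subfield.mem_bot_iff_pow_eq_self (AlgebraicClosure (ZMod p)) p).2 h
  rw [← ZMod.fieldRange_castHom_eq_bot p] at h1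
  obtain ⟨c, rfl⟩ := h1
  exact ⟨c.val, c.val_lt, by simp⟩

theorem natCast_pow_self (p : ℕ) [Fact p.Prime] (n : ℕ) :
    (n : AlgebraicClosure (ZMod p)) ^ p = n := by
  have := congrArg (algebraMap (ZMod p) (AlgebraicClosure (ZMod p))) (ZMod.pow_card (n : ZMod p))
  rwa [map_pow, map_natCast] at this

theorem natCast_eq_iff (p : ℕ) [Fact p.Prime] (m n : ℕ) :
    (m : AlgebraicClosure (ZMod p)) = n ↔ m % p = n % p := by
  exact CharP.cast_eq_iff_mod_eq _ p

theorem intCast_eq_zero_iff (p : ℕ) [Fact p.Prime] (n : ℤ) :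
    (n : AlgebraicClosure (ZMod p)) = 0 ↔ (p : ℤ) ∣ n :=
  CharP.intCast_eq_zero_iff _ p n

omit [IsDomain S] [Algebra ℤ[X] S] [FaithfulSMul ℤ[X] S] [Finite Γ] [SMulCommClass Γ ℤ[X] S]
  [Algebra.IsInvariant ℤ[X] S Γ] in
theorem smul_ofNat (g : Γ) (n : ℕ) [n.AtLeastTwo] :
    g • (OfNat.ofNat n : S) = OfNat.ofNat n :=
  map_ofNat (MulSemiringAction.toRingHom Γ S g) n

variable (Γ) in
theorem exists_smul_eq_neg {a : S} (ha : a ^ 2 = -5) : ∃ h : Γ, h • a = -a := by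
  have : Fact (Nat.Prime 11) := ⟨by norm_num⟩
  obtain ⟨ψ, g, -, hg⟩ := exists_frobenius S Γ 11 0
  have h5 : (g • a) ^ 2 = a ^ 2 := by
    rw [← smul_pow', ha]
    rw [smul_neg, smul_ofNat]
  obtain h | h := sq_eq_sq_iff_eq_or_eq_neg.1 h5
  · have h1 := hg a
    rw [h] at h1
    obtain ⟨n, hn, h2⟩ := exists_nat_of_pow_eq h1.symm
    have h3 := congrArg ψ ha
    rw [map_pow, h2, map_neg, map_ofNat, eq_neg_iff_add_eq_zero] at h3
    have h4 := (intCast_eq_zero_iff 11 (n ^ 2 + 5)).1 (by push_cast; exact h3)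
    exact absurd h4 (by
      have key : ∀ n < 11, ¬ 11 ∣ n ^ 2 + 5 := by decide
      exact_mod_cast key n hn)
  · exact ⟨g, h⟩

/-- The homomorphism `ψ` specializes `(√-5, t)` to `(a₀, t₀)` modulo `p`, and `g` induces
the Frobenius. -/
structure IsSpecialization (a : S) (p a₀ t₀ : ℕ) [Fact p.Prime]
    (ψ : S →+* AlgebraicClosure (ZMod p)) (g : Γ) : Prop where
  map_t : ψ (algebraMap ℤ[X] S X) = t₀
  map_a : ψ a = a₀
  frob : ∀ s, ψ (g • s) = ψ s ^ p

variable (Γ) in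
theorem exists_isSpecialization {a : S} (ha : a ^ 2 = -5) (p a₀ t₀ : ℕ) [Fact p.Prime]
    (h0 : p ∣ a₀ ^ 2 + 5) :
    ∃ (ψ : S →+* AlgebraicClosure (ZMod p)) (g : Γ), IsSpecialization a p a₀ t₀ ψ g := by
  obtain ⟨ψ, g, ht, hg⟩ := exists_frobenius S Γ p t₀
  have h1 : ψ a ^ 2 = (a₀ : AlgebraicClosure (ZMod p)) ^ 2 := by
    have h2 : ((a₀ ^ 2 + 5 : ℕ) : AlgebraicClosure (ZMod p)) = 0 :=
      (CharP.cast_eq_zero_iff _ p _).2 h0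
    rw [← map_pow, ha, map_neg, map_ofNat, eq_comm, eq_neg_iff_add_eq_zero]
    exact_mod_cast h2
  obtain h2 | h2 := sq_eq_sq_iff_eq_or_eq_neg.1 h1
  · exact ⟨ψ, g, ht, h2, hg⟩
  · obtain ⟨h, hh⟩ := exists_smul_eq_neg Γ ha
    refine ⟨ψ.comp (MulSemiringAction.toRingHom Γ S h), h⁻¹ * g * h, ?_, ?_, fun s => ?_⟩
    · simpa [smul_algebraMap] using ht
    · simp [hh, h2]
    · simp [mul_smul, hg]

namespace IsSpecialization

variable {a : S} {p a₀ t₀ : ℕ} [Fact p.Prime] {ψ : S →+* AlgebraicClosure (ZMod p)} {g : Γ}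

omit [Finite Γ] [FaithfulSMul ℤ[X] S] [Algebra.IsInvariant ℤ[X] S Γ] [IsDomain S]
  [SMulCommClass Γ ℤ[X] S] in
theorem frob_pow (h : IsSpecialization a p a₀ t₀ ψ g) (k : ℕ) (s : S) :
    ψ (g ^ k • s) = ψ s ^ p ^ k := by
  induction k with
  | zero => simp
  | succ k ih => rw [pow_succ', mul_smul, h.frob, ih, ← pow_mul, pow_succ]

end IsSpecialization
end Reduction

section Roots

/-- The roots of `dodecic a t X` in `S`, together with square roots of their multiples by `5`. -/
structure Factorization {S : Type*} [CommRing S] (a t : S) where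
  z : Fin 12 → S
  w : Fin 12 → S
  dodecic_eq : dodecic (C a) (C t) (X : S[X]) = ∏ i, (X - C (z i))
  w_sq : ∀ i, w i ^ 2 = 5 * z i

namespace Factorization

variable {S : Type*} [CommRing S] {a t : S} (F : Factorization a t)

include F in
theorem map_eq {R : Type*} [CommRing R] (ψ : S →+* R) :
    dodecic (C (ψ a)) (C (ψ t)) (X : R[X]) = ∏ i, (X - C (ψ (F.z i))) := by
  have := congrArg (Polynomial.mapRingHom ψ) F.dodecic_eq
  rw [map_dodecic] at this
  simpa [Polynomial.map_prod] using this

theorem eval_map {R : Type*} [CommRing R] (ψ : S →+* R) (c : R) :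
    dodecic (ψ a) (ψ t) c = ∏ i, (c - ψ (F.z i)) := by
  have := congrArg (Polynomial.evalRingHom c) (F.map_eq ψ)
  rw [map_dodecic] at this
  simpa [Polynomial.eval_prod] using this

theorem dodecic_z (i : Fin 12) : dodecic a t (F.z i) = 0 := by
  have := F.eval_map (RingHom.id S) (F.z i)
  rw [RingHom.id_apply, RingHom.id_apply] at this
  exact this.trans (Finset.prod_eq_zero (Finset.mem_univ i) (by simp))

theorem exists_z_of_map {R : Type*} [CommRing R] [IsDomain R] (ψ : S →+* R) {c : R}
    (h : dodecic (ψ a) (ψ t) c = 0) : ∃ i, ψ (F.z i) = c := by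
  rw [F.eval_map ψ, Finset.prod_eq_zero_iff] at h
  obtain ⟨i, -, h⟩ := h
  exact ⟨i, (sub_eq_zero.1 h).symm⟩

theorem exists_z [IsDomain S] {s : S} (h : dodecic a t s = 0) : ∃ i, F.z i = s :=
  F.exists_z_of_map (RingHom.id S) h

end Factorization

/-- `X ^ (p ^ k) = X` modulo `p` and the specialized polynomial `dodecic a₀ t₀ X`. -/
def Splits (p a₀ t₀ k : ℕ) : Prop :=
  p < 64 ∧ frob p (tail p a₀ t₀) k = 0 :: 1 :: List.replicate 10 0

instance (p a₀ t₀ k : ℕ) : Decidable (Splits p a₀ t₀ k) :=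
  inferInstanceAs (Decidable (_ ∧ _))

theorem Splits.pow_eq {p a₀ t₀ k : ℕ} (h : Splits p a₀ t₀ k) {R : Type*} [CommRing R]
    [Fact p.Prime] [CharP R p] {α : R} (hα : dodecic (a₀ : R) t₀ α = 0) : α ^ p ^ k = α := by
  have := evalList_frob (p := p) h.1 (evalList_tail p a₀ t₀ α hα)
    (by rw [length_tail]; norm_num) k
  rw [h.2] at this
  rw [← this]
  simp [evalList]

variable {S Γ : Type*} [CommRing S] [IsDomain S] [Algebra ℤ[X] S]
  [Group Γ] [MulSemiringAction Γ S] [SMulCommClass Γ ℤ[X] S]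
  {a : S} {p a₀ t₀ : ℕ} [Fact p.Prime] {ψ : S →+* AlgebraicClosure (ZMod p)} {g : Γ}

theorem smul_dodecic (h : g • a = a) {s : S} (hs : dodecic a (algebraMap ℤ[X] S X) s = 0) :
    dodecic a (algebraMap ℤ[X] S X) (g • s) = 0 := by
  have := map_dodecic (MulSemiringAction.toRingHom Γ S g) a (algebraMap ℤ[X] S X) s
  simp only [MulSemiringAction.toRingHom_apply, h, smul_algebraMap, hs, smul_zero] at this
  exact this.symm

namespace IsSpecialization

variable (H : IsSpecialization a p a₀ t₀ ψ g) {k : ℕ}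
include H

theorem dodecic_map {s : S} (hs : dodecic a (algebraMap ℤ[X] S X) s = 0) :
    dodecic (a₀ : AlgebraicClosure (ZMod p)) t₀ (ψ s) = 0 := by
  rw [← H.map_a, ← H.map_t, ← map_dodecic, hs, map_zero]

theorem injective (F : Factorization a (algebraMap ℤ[X] S X)) (hk : Splits p a₀ t₀ k)
    (h0 : k ≠ 0) : Function.Injective (fun i => ψ (F.z i)) := by
  rw [← separable_prod_X_sub_C_iff, ← F.map_eq ψ, H.map_a, H.map_t, C_eq_natCast, C_eq_natCast]
  let f : (AlgebraicClosure (ZMod p))[X] := dodecic (a₀ : (AlgebraicClosure (ZMod p))[X]) t₀ X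
  suffices f ∣ X ^ p ^ k - X from (galois_poly_separable p (p ^ k) (dvd_pow_self p h0)).of_dvd this
  rw [← AdjoinRoot.mk_eq_zero, map_sub, map_pow, sub_eq_zero]
  by_cases hf : Subsingleton (AdjoinRoot f)
  · exact Subsingleton.elim _ _
  · rw [not_subsingleton_iff_nontrivial] at hf
    have : CharP (AdjoinRoot f) p :=
      charP_of_injective_algebraMap (algebraMap (AlgebraicClosure (ZMod p)) _).injective p
    apply hk.pow_eq
    have := map_dodecic (AdjoinRoot.mk f) (a₀ : (AlgebraicClosure (ZMod p))[X]) t₀ X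
    rw [map_natCast, map_natCast] at this
    rw [← this]
    exact AdjoinRoot.mk_self

variable {s s' : S}

theorem eq_of_map_eq (F : Factorization a (algebraMap ℤ[X] S X)) (hk : Splits p a₀ t₀ k)
    (h0 : k ≠ 0) (hs : dodecic a (algebraMap ℤ[X] S X) s = 0)
    (hs' : dodecic a (algebraMap ℤ[X] S X) s' = 0) (h : ψ s = ψ s') : s = s' := by
  obtain ⟨i, rfl⟩ := F.exists_z hs
  obtain ⟨j, rfl⟩ := F.exists_z hs'
  rw [H.injective F hk h0 h]

/-- An element whose square is fixed by `g` and whose reduction is rational is fixed. -/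
theorem smul_eq_self (hs : g • s ^ 2 = s ^ 2) (h2 : p ≠ 2) (h0 : ψ s ≠ 0)
    (h : ψ s ^ p = ψ s) : g • s = s := by
  rw [smul_pow'] at hs
  obtain h1 | h1 := sq_eq_sq_iff_eq_or_eq_neg.1 hs
  · exact h1
  · have h3 := H.frob s
    have : NeZero (2 : AlgebraicClosure (ZMod p)) :=
      ⟨Ring.two_ne_zero (by rwa [ringChar.eq _ p])⟩
    rw [h1, map_neg, h, neg_eq_iff_add_eq_zero, ← two_mul] at h3
    simp_all

theorem smul_a (h : (a : S) ^ 2 = -5) (h2 : p ≠ 2) (h0 : ¬ p ∣ a₀) : g • a = a := by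
  refine H.smul_eq_self ?_ h2 ?_ ?_
  · rw [h, smul_neg, smul_ofNat]
  · rwa [H.map_a, Ne, CharP.cast_eq_zero_iff _ p]
  · rw [H.map_a, natCast_pow_self]

/-- A square root of `n` is fixed by `g` if `n` is a nonzero square modulo `p`. -/
theorem smul_eq_self_of_sq {c n : ℕ} (hs : g • s ^ 2 = s ^ 2) (h2 : p ≠ 2) (h : ψ s ^ 2 = n)
    (h0 : ¬ p ∣ n) (hc : c ^ 2 % p = n % p) : g • s = s := by
  have h3 : (n : AlgebraicClosure (ZMod p)) ≠ 0 := by rwa [Ne, CharP.cast_eq_zero_iff _ p]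
  refine H.smul_eq_self hs h2 (fun h1 => h3 ?_) ?_
  · rw [← h, h1, zero_pow two_ne_zero]
  · rw [← (natCast_eq_iff p _ _).2 hc, Nat.cast_pow] at h
    obtain h1 | h1 := sq_eq_sq_iff_eq_or_eq_neg.1 h
    · rw [h1, natCast_pow_self]
    · rw [h1, Odd.neg_pow ((Fact.out : p.Prime).odd_of_ne_two h2), natCast_pow_self]

/-- A square root of `n` is negated by `g` if `n` is not a square modulo `p`. -/
theorem smul_eq_neg_of_sq {n : ℕ} (hs : g • s ^ 2 = s ^ 2) (h : ψ s ^ 2 = n)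
    (hc : ∀ c < p, c ^ 2 % p ≠ n % p) : g • s = -s := by
  rw [smul_pow'] at hs
  refine (sq_eq_sq_iff_eq_or_eq_neg.1 hs).resolve_left fun h1 => ?_
  have h3 := H.frob s
  rw [h1] at h3
  obtain ⟨c, hcp, h4⟩ := exists_nat_of_pow_eq h3.symm
  refine hc c hcp ((natCast_eq_iff p _ _).1 ?_)
  rw [← h, h4, Nat.cast_pow]

end IsSpecialization

end Roots

section Orbits

variable {Γ α : Type*} [Group Γ] [MulAction Γ α]

theorem card_eq_ncard_orbit_mul [Finite Γ] (H : Subgroup Γ) (x : α) :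
    Nat.card H = (MulAction.orbit H x).ncard *
      Nat.card (H ⊓ MulAction.stabilizer Γ x : Subgroup Γ) := by
  have h1 := MulAction.index_stabilizer H x
  have h2 := (MulAction.stabilizer H x).index_mul_card
  rw [← h2, h1]
  congr 1
  refine Nat.card_congr
    ⟨fun g => ⟨g.1.1, g.1.2, g.2⟩, fun g => ⟨⟨g.1, g.2.1⟩, g.2.2⟩, fun _ => rfl, fun _ => rfl⟩

theorem ncard_modEq_ncard_fixed {O : Set α} (hO : O.Finite) {g : Γ} (hg : ∀ x ∈ O, g • x ∈ O)
    {p n : ℕ} [Fact p.Prime] (hp : ∀ x ∈ O, g ^ p ^ n • x = x) :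
    O.ncard ≡ {x ∈ O | g • x = x}.ncard [MOD p] := by
  classical
  have : Fintype O := hO.fintype
  let f : Function.End O := fun x => ⟨g • x.1, hg _ x.2⟩
  have hf : ∀ k (x : O), ((f ^ k) x : α) = g ^ k • (x : α) := by
    intro k
    induction k with
    | zero =>
      intro x
      rw [pow_zero, pow_zero, one_smul]
      rfl
    | succ k ih =>
      intro x
      rw [pow_succ', pow_succ', mul_smul, ← ih]
      rfl
  have h1 : f ^ p ^ n = 1 := by
    funext x
    exact Subtype.ext ((hf _ x).trans (hp _ x.2))
  have := Equiv.Perm.card_fixedPoints_modEq h1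
  rw [← Nat.card_eq_fintype_card, ← Nat.card_eq_fintype_card] at this
  convert this using 1
  rw [← Nat.card_coe_set_eq]
  refine Nat.card_congr ⟨fun x => ⟨⟨x.1, x.2.1⟩, Subtype.ext x.2.2⟩,
    fun x => ⟨x.1.1, x.1.2, congrArg Subtype.val x.2⟩, fun _ => rfl, fun _ => rfl⟩

theorem four_dvd_ncard {O : Set α} (hO : O.Finite) {g : Γ} (hg : ∀ x ∈ O, g • x ∈ O)
    (h4 : ∀ x ∈ O, g ^ 4 • x = x) (h2 : ∀ x ∈ O, g ^ 2 • x ≠ x) : 4 ∣ O.ncard := by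
  classical
  have : Fintype O := hO.fintype
  let σ : Equiv.Perm O := Equiv.ofBijective (fun x => ⟨g • x.1, hg _ x.2⟩)
    (Finite.injective_iff_bijective.1 fun x y h =>
      Subtype.ext (MulAction.injective g (congrArg Subtype.val h)))
  have hper : ∀ k (x : O), (((σ • ·)^[k] x : O) : α) = g ^ k • (x : α) := by
    intro k
    induction k with
    | zero => intro x; simp
    | succ k ih =>
      intro x
      rw [Function.iterate_succ_apply', pow_succ', mul_smul, ← ih]
      rfl
  have hmin (x : O) : Function.minimalPeriod (σ • ·) x = 4 := by
    have hd : Function.minimalPeriod (σ • ·) x ∣ 2 ^ 2 :=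
      Function.IsPeriodicPt.minimalPeriod_dvd (Subtype.ext ((hper 4 x).trans (h4 _ x.2)))
    have hn : ¬ Function.minimalPeriod (σ • ·) x ∣ 2 ^ 1 := fun h =>
      h2 _ x.2 ((hper 2 x).symm.trans (congrArg Subtype.val
        (Function.isPeriodicPt_iff_minimalPeriod_dvd.2 h)))
    obtain ⟨k, hk, hk'⟩ := (Nat.dvd_prime_pow Nat.prime_two).1 hd
    rw [hk'] at hn ⊢
    interval_cases k <;> simp_all
  rw [← Nat.card_coe_set_eq,
    Nat.card_congr (MulAction.selfEquivSigmaOrbits (Subgroup.zpowers σ) O), Nat.card_sigma]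
  refine Finset.dvd_sum fun ω _ => ?_
  rw [Nat.card_eq_fintype_card, ← MulAction.minimalPeriod_eq_card, hmin]

theorem finite_orbit [Finite Γ] (H : Subgroup Γ) (x : α) : (MulAction.orbit H x).Finite :=
  Set.finite_range _

section FiniteGroup

variable [Finite Γ] {H : Subgroup Γ} {x : α}

theorem ncard_orbit_pos : 0 < (MulAction.orbit H x).ncard :=
  (Set.ncard_pos (finite_orbit H x)).2 ⟨x, MulAction.mem_orbit_self x⟩

theorem smul_mem_orbit {g : Γ} (hg : g ∈ H) {y : α} (hy : y ∈ MulAction.orbit H x) :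
    g • y ∈ MulAction.orbit H x :=
  MulAction.mem_orbit_of_mem_orbit (⟨g, hg⟩ : H) hy

theorem ncard_orbit_modEq {g : Γ} (hg : g ∈ H) {p n : ℕ} [Fact p.Prime]
    (hp : ∀ y ∈ MulAction.orbit H x, g ^ p ^ n • y = y) :
    (MulAction.orbit H x).ncard ≡ {y ∈ MulAction.orbit H x | g • y = y}.ncard [MOD p] :=
  ncard_modEq_ncard_fixed (finite_orbit H x) (fun _ hy => smul_mem_orbit hg hy) hp

theorem dvd_ncard_orbit {g : Γ} (hg : g ∈ H) {p n : ℕ} [Fact p.Prime]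
    (hp : ∀ y ∈ MulAction.orbit H x, g ^ p ^ n • y = y)
    (hf : ∀ y ∈ MulAction.orbit H x, g • y ≠ y) : p ∣ (MulAction.orbit H x).ncard := by
  have h1 := ncard_orbit_modEq hg hp
  have h2 : {y ∈ MulAction.orbit H x | g • y = y} = ∅ := Set.eq_empty_of_forall_notMem
    fun y hy => hf y hy.1 hy.2
  rw [h2, Set.ncard_empty] at h1
  exact Nat.dvd_of_mod_eq_zero h1

theorem two_le_ncard_orbit {g : Γ} (hg : g ∈ H) (h : g • x ≠ x) :
    2 ≤ (MulAction.orbit H x).ncard :=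
  (Set.one_lt_ncard (finite_orbit H x)).2
    ⟨g • x, MulAction.mem_orbit x (⟨g, hg⟩ : H), x, MulAction.mem_orbit_self x, h⟩

theorem ncard_orbit_le {β : Type*} {f : β → α} {B : Finset β}
    (hsub : MulAction.orbit H x ⊆ f '' B) : (MulAction.orbit H x).ncard ≤ B.card :=
  (Set.ncard_le_ncard hsub).trans ((Set.ncard_image_le).trans_eq (Set.ncard_coe_finset B))

theorem exists_smul_eq_of_card_le {β : Type*} {f : β → α} {B : Finset β}
    (hsub : MulAction.orbit H x ⊆ f '' B) (hle : B.card ≤ (MulAction.orbit H x).ncard) {b : β}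
    (hb : b ∈ B) : ∃ g ∈ H, g • x = f b := by
  have h1 : MulAction.orbit H x = f '' B := Set.eq_of_subset_of_ncard_le hsub
    (((Set.ncard_image_le).trans_eq (Set.ncard_coe_finset B)).trans hle)
  have h2 : f b ∈ MulAction.orbit H x := h1 ▸ Set.mem_image_of_mem f hb
  obtain ⟨g, hg⟩ := h2
  exact ⟨g.1, g.2, hg⟩

end FiniteGroup

end Orbits

section Elements

/-- The roots of the specialized polynomial `dodecic a₀ t₀ X` in the prime field. -/
def RationalRoots (p a₀ t₀ : ℕ) (l : List ℕ) : Prop :=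
  (∀ n < p, (p : ℤ) ∣ dodecic (a₀ : ℤ) t₀ n → n ∈ l) ∧ ∀ n ∈ l, (p : ℤ) ∣ dodecic (a₀ : ℤ) t₀ n

instance (p a₀ t₀ : ℕ) (l : List ℕ) : Decidable (RationalRoots p a₀ t₀ l) :=
  inferInstanceAs (Decidable (_ ∧ _))

theorem dodecic_natCast_eq_zero_iff (p a₀ t₀ n : ℕ) [Fact p.Prime] :
    dodecic (a₀ : AlgebraicClosure (ZMod p)) t₀ n = 0 ↔ (p : ℤ) ∣ dodecic (a₀ : ℤ) t₀ n := by
  rw [← intCast_eq_zero_iff p, ← eq_intCast (Int.castRingHom (AlgebraicClosure (ZMod p))),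
    map_dodecic]
  simp

variable {S Γ : Type*} [CommRing S] [IsDomain S] [Algebra ℤ[X] S]
  [Group Γ] [MulSemiringAction Γ S] [SMulCommClass Γ ℤ[X] S]
  {a : S} {p a₀ t₀ k : ℕ} {l : List ℕ} [Fact p.Prime] {ψ : S →+* AlgebraicClosure (ZMod p)} {g : Γ}
  (F : Factorization a (algebraMap ℤ[X] S X))

namespace IsSpecialization

variable (H : IsSpecialization a p a₀ t₀ ψ g)
include H

theorem exists_of_fixed (hl : RationalRoots p a₀ t₀ l) {s : S}
    (hs : dodecic a (algebraMap ℤ[X] S X) s = 0) (hg : ψ (g • s) = ψ s) : ∃ n ∈ l, ψ s = n := by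
  rw [H.frob] at hg
  obtain ⟨n, hn, h⟩ := exists_nat_of_pow_eq hg
  exact ⟨n, hl.1 n hn ((dodecic_natCast_eq_zero_iff p a₀ t₀ n).1 (h ▸ H.dodecic_map hs)), h⟩

theorem exists_fixed (hk : Splits p a₀ t₀ k) (h0 : k ≠ 0) (hga : g • a = a)
    (hl : RationalRoots p a₀ t₀ l) {n : ℕ} (hn : n ∈ l) :
    ∃ i, ψ (F.z i) = n ∧ g • F.z i = F.z i := by
  have h1 := (dodecic_natCast_eq_zero_iff p a₀ t₀ n).2 (hl.2 n hn)
  rw [← H.map_a, ← H.map_t] at h1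
  obtain ⟨i, hi⟩ := F.exists_z_of_map ψ h1
  refine ⟨i, hi, H.eq_of_map_eq F hk h0 (smul_dodecic hga (F.dodecic_z i)) (F.dodecic_z i) ?_⟩
  rw [H.frob, hi, natCast_pow_self]

theorem pow_smul_z (hk : Splits p a₀ t₀ k) (h0 : k ≠ 0) (hga : g • a = a) (i : Fin 12) :
    g ^ k • F.z i = F.z i := by
  have hga' : g ^ k • a = a :=
    (MulAction.stabilizer Γ a).pow_mem (MulAction.mem_stabilizer_iff.2 hga) k
  refine H.eq_of_map_eq F hk h0 (smul_dodecic hga' (F.dodecic_z i)) (F.dodecic_z i) ?_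
  rw [H.frob_pow, hk.pow_eq (H.dodecic_map (F.dodecic_z i))]

end IsSpecialization

namespace Factorization

variable {F}

omit [IsDomain S] [SMulCommClass Γ ℤ[X] S] in
theorem smul_w_sq {i : Fin 12} (h : g • F.z i = F.z i) : g • F.w i ^ 2 = F.w i ^ 2 := by
  rw [F.w_sq, smul_mul', smul_ofNat, h]

omit [SMulCommClass Γ ℤ[X] S] in
theorem smul_w {i : Fin 12} (h : g • F.z i = F.z i) : g • F.w i = F.w i ∨ g • F.w i = -F.w i := by
  apply sq_eq_sq_iff_eq_or_eq_neg.1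
  rw [← smul_pow', smul_w_sq h]

omit [SMulCommClass Γ ℤ[X] S] in
theorem sq_smul_w {i : Fin 12} (h : g • F.z i = F.z i) : g ^ 2 • F.w i = F.w i := by
  rw [sq, mul_smul]
  obtain h1 | h1 := smul_w h <;> simp [h1]

end Factorization

/-- The specialization of `dodecic` at `(a₀, t₀)` modulo `p` splits over the field with `p ^ k`
elements, and its roots in the prime field are the elements of `l`. -/
structure FrobData (p a₀ t₀ k : ℕ) (l : List ℕ) : Prop where
  ne_two : p ≠ 2
  dvd : p ∣ a₀ ^ 2 + 5
  not_dvd : ¬ p ∣ a₀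
  ne_zero : k ≠ 0
  splits : Splits p a₀ t₀ k
  roots : RationalRoots p a₀ t₀ l

theorem FrobData.exists [Finite Γ] [FaithfulSMul ℤ[X] S] [Algebra.IsInvariant ℤ[X] S Γ]
    (ha : a ^ 2 = -5) (D : FrobData p a₀ t₀ k l) :
    ∃ (ψ : S →+* AlgebraicClosure (ZMod p)) (g : Γ) (e : ℕ → Fin 12),
      IsSpecialization a p a₀ t₀ ψ g ∧ g • a = a ∧ (∀ i, g ^ k • F.z i = F.z i) ∧
      (∀ n ∈ l, ψ (F.z (e n)) = n ∧ g • F.z (e n) = F.z (e n)) ∧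
      ∀ i, g • F.z i = F.z i → ∃ n ∈ l, i = e n := by
  obtain ⟨ψ, g, H⟩ := exists_isSpecialization Γ ha p a₀ t₀ D.dvd
  have hga := H.smul_a ha D.ne_two D.not_dvd
  choose! e he using fun n (hn : n ∈ l) =>
    H.exists_fixed F D.splits D.ne_zero hga D.roots hn
  refine ⟨ψ, g, e, H, hga, H.pow_smul_z F D.splits D.ne_zero hga, he, fun i hi => ?_⟩
  obtain ⟨n, hn, h⟩ := H.exists_of_fixed D.roots (F.dodecic_z i) (congrArg ψ hi)
  exact ⟨n, hn, H.injective F D.splits D.ne_zero (h.trans (he n hn).1.symm)⟩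

namespace IsSpecialization

variable {F} (H : IsSpecialization a p a₀ t₀ ψ g)
include H

theorem smul_w_eq_self {i : Fin 12} {n c : ℕ} (hp : p ≠ 2) (hi : g • F.z i = F.z i)
    (hn : ψ (F.z i) = n) (h0 : ¬ p ∣ 5 * n) (hc : c ^ 2 % p = 5 * n % p) :
    g • F.w i = F.w i :=
  H.smul_eq_self_of_sq (Factorization.smul_w_sq hi) hp
    (by rw [← map_pow, F.w_sq, map_mul, hn, map_ofNat]; push_cast; rfl) h0 hc

theorem smul_w_eq_neg {i : Fin 12} {n : ℕ} (hi : g • F.z i = F.z i)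
    (hn : ψ (F.z i) = n) (hc : ∀ c < p, c ^ 2 % p ≠ 5 * n % p) :
    g • F.w i = -F.w i :=
  H.smul_eq_neg_of_sq (Factorization.smul_w_sq hi)
    (by rw [← map_pow, F.w_sq, map_mul, hn, map_ofNat]; push_cast; rfl) hc

theorem smul_sqrt_three {s : S} (hs : s ^ 2 = 3) {c : ℕ} (hp : p ≠ 2) (h3 : ¬ p ∣ 3)
    (hc : c ^ 2 % p = 3 % p) : g • s = s :=
  H.smul_eq_self_of_sq (by rw [hs, smul_ofNat]) hp
    (by rw [← map_pow, hs, map_ofNat]; push_cast; rfl) h3 hc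

theorem smul_sqrt_three_neg {s : S} (hs : s ^ 2 = 3) (hc : ∀ c < p, c ^ 2 % p ≠ 3 % p) :
    g • s = -s :=
  H.smul_eq_neg_of_sq (by rw [hs, smul_ofNat])
    (by rw [← map_pow, hs, map_ofNat]; push_cast; rfl) hc

end IsSpecialization

variable (Γ) in
/-- The stabilizer of `√-5` and `√3`. -/
def geometric (a s : S) : Subgroup Γ := MulAction.stabilizer Γ a ⊓ MulAction.stabilizer Γ s

omit [IsDomain S] [Algebra ℤ[X] S] [SMulCommClass Γ ℤ[X] S] in
theorem mem_geometric {s : S} : g ∈ geometric Γ a s ↔ g • a = a ∧ g • s = s := Iff.rfl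

omit [IsDomain S] [Algebra ℤ[X] S] [SMulCommClass Γ ℤ[X] S] in
theorem smul_eq_of_sq_smul {x : S} (h : g ^ 2 • x = x) {n : ℕ} (hn : g ^ (2 * n + 1) • x = x) :
    g • x = x := by
  rwa [pow_succ', pow_mul, mul_smul,
    (MulAction.stabilizer Γ x).pow_mem (MulAction.mem_stabilizer_iff.2 h) n] at hn

section Existence

variable [Finite Γ] [FaithfulSMul ℤ[X] S] [Algebra.IsInvariant ℤ[X] S Γ] {s : S}

variable (Γ) in
theorem exists_type_1_11 (ha : a ^ 2 = -5) (hs : s ^ 2 = 3) :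
    (∃ g : Γ, g • a = a ∧ g • s = -s) ∧ ∃ g ∈ geometric Γ a s, ∃ i, g • F.w i = F.w i ∧
      (∀ j, g • F.z j = F.z j → j = i) ∧ (∀ j, g ^ 11 • F.z j = F.z j) ∧
      ∀ j, g ^ 11 • F.w j = F.w j := by
  have : Fact (Nat.Prime 7) := ⟨by norm_num⟩
  have D : FrobData 7 4 2 11 [5] := ⟨by norm_num, by norm_num, by norm_num, by norm_num,
    by decide +kernel, by decide +kernel⟩
  obtain ⟨ψ, g, e, H, hga, hz, he, hf⟩ := D.exists (Γ := Γ) F ha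
  have hgs := H.smul_sqrt_three_neg hs (by decide)
  obtain ⟨-, h5⟩ := he 5 (by simp)
  refine ⟨⟨g, hga, hgs⟩, g ^ 2, mem_geometric.2 ⟨?_, ?_⟩, e 5, Factorization.sq_smul_w h5,
    fun j hj => ?_, fun j => ?_, fun j => ?_⟩
  · rw [sq, mul_smul, hga, hga]
  · rw [sq, mul_smul, hgs, smul_neg, hgs, neg_neg]
  · obtain ⟨n, hn, rfl⟩ := hf j (smul_eq_of_sq_smul hj (n := 5) (hz j))
    rw [List.mem_singleton.1 hn]
  · rw [pow_right_comm, sq, mul_smul, hz, hz]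
  · rw [pow_right_comm]
    exact Factorization.sq_smul_w (hz j)

variable (Γ) in
theorem exists_type_4_8 (ha : a ^ 2 = -5) (hs : s ^ 2 = 3) :
    ∃ g ∈ geometric Γ a s, (∀ j, g • F.z j ≠ F.z j) ∧ ∀ j, g ^ 2 ^ 3 • F.z j = F.z j := by
  have : Fact (Nat.Prime 23) := ⟨by norm_num⟩
  have D : FrobData 23 8 6 8 [] := ⟨by norm_num, by norm_num, by norm_num, by norm_num,
    by decide +kernel, by decide +kernel⟩
  obtain ⟨ψ, g, e, H, hga, hz, he, hf⟩ := D.exists (Γ := Γ) F ha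
  refine ⟨g, mem_geometric.2 ⟨hga, H.smul_sqrt_three (c := 7) hs D.ne_two (by norm_num)
    (by norm_num)⟩, fun j hj => ?_, hz⟩
  simpa using hf j hj

variable (Γ) in
theorem exists_type_1_1_2_8 (ha : a ^ 2 = -5) (hs : s ^ 2 = 3) :
    ∃ g ∈ geometric Γ a s, ∃ i j, g • F.w i = F.w i ∧ g • F.z j = F.z j ∧ g • F.w j = -F.w j ∧
      (∀ k, g • F.z k = F.z k → k = i ∨ k = j) ∧ ∀ k, g ^ 2 ^ 4 • F.w k = F.w k := by
  have : Fact (Nat.Prime 23) := ⟨by norm_num⟩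
  have D : FrobData 23 8 10 8 [15, 4] := ⟨by norm_num, by norm_num, by norm_num, by norm_num,
    by decide +kernel, by decide +kernel⟩
  obtain ⟨ψ, g, e, H, hga, hz, he, hf⟩ := D.exists (Γ := Γ) F ha
  obtain ⟨h1, h2⟩ := he 15 (by simp)
  obtain ⟨h3, h4⟩ := he 4 (by simp)
  refine ⟨g, mem_geometric.2 ⟨hga, H.smul_sqrt_three (c := 7) hs D.ne_two (by norm_num)
    (by norm_num)⟩, e 15, e 4, H.smul_w_eq_self (c := 11) D.ne_two h2 h1 (by norm_num)
    (by norm_num), h4, H.smul_w_eq_neg h4 h3 (by decide), fun k hk => ?_, fun k => ?_⟩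
  · obtain ⟨n, hn, rfl⟩ := hf k hk
    aesop
  · rw [pow_succ, pow_mul]
    exact Factorization.sq_smul_w (hz k)

variable (Γ) in
theorem exists_type_1_1_5_5 (ha : a ^ 2 = -5) (hs : s ^ 2 = 3) :
    ∃ g ∈ geometric Γ a s, ∃ i j, i ≠ j ∧ g • F.w i = F.w i ∧ g • F.w j = F.w j ∧
      (∀ k, g • F.z k = F.z k → k = i ∨ k = j) ∧ ∀ k, g ^ 5 • F.z k = F.z k := by
  have : Fact (Nat.Prime 23) := ⟨by norm_num⟩
  have D : FrobData 23 8 21 5 [20, 11] := ⟨by norm_num, by norm_num, by norm_num, by norm_num,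
    by decide +kernel, by decide +kernel⟩
  obtain ⟨ψ, g, e, H, hga, hz, he, hf⟩ := D.exists (Γ := Γ) F ha
  obtain ⟨h1, h2⟩ := he 20 (by simp)
  obtain ⟨h3, h4⟩ := he 11 (by simp)
  refine ⟨g ^ 2, Subgroup.pow_mem _ (mem_geometric.2 ⟨hga, H.smul_sqrt_three (c := 7) hs D.ne_two
    (by norm_num) (by norm_num)⟩) 2, e 20, e 11, fun h => ?_, Factorization.sq_smul_w h2,
    Factorization.sq_smul_w h4, fun k hk => ?_, fun k => ?_⟩
  · rw [h, h3, natCast_eq_iff] at h1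
    norm_num at h1
  · obtain ⟨n, hn, rfl⟩ := hf k (smul_eq_of_sq_smul hk (n := 2) (hz k))
    aesop
  · rw [pow_right_comm, sq, mul_smul, hz, hz]

variable (Γ) in
theorem exists_type_1_1_1_3_3_3 (ha : a ^ 2 = -5) (hs : s ^ 2 = 3) :
    ∃ g ∈ geometric Γ a s, ∃ i j l, i ≠ j ∧ i ≠ l ∧ j ≠ l ∧ g • F.w i = F.w i ∧
      g • F.w j = F.w j ∧ g • F.z l = F.z l ∧
      (∀ k, g • F.z k = F.z k → k = i ∨ k = j ∨ k = l) ∧ ∀ k, g ^ 3 • F.z k = F.z k := by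
  have : Fact (Nat.Prime 47) := ⟨by norm_num⟩
  have D : FrobData 47 18 37 3 [18, 6, 17] := ⟨by norm_num, by norm_num, by norm_num, by norm_num,
    by decide +kernel, by decide +kernel⟩
  obtain ⟨ψ, g, e, H, hga, hz, he, hf⟩ := D.exists (Γ := Γ) F ha
  obtain ⟨h1, h2⟩ := he 18 (by simp)
  obtain ⟨h3, h4⟩ := he 6 (by simp)
  obtain ⟨h5, h6⟩ := he 17 (by simp)
  refine ⟨g ^ 2, Subgroup.pow_mem _ (mem_geometric.2 ⟨hga, H.smul_sqrt_three (c := 12) hs D.ne_two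
    (by norm_num) (by norm_num)⟩) 2, e 18, e 6, e 17, fun h => ?_, fun h => ?_, fun h => ?_,
    Factorization.sq_smul_w h2, Factorization.sq_smul_w h4, by rw [sq, mul_smul, h6, h6],
    fun k hk => ?_, fun k => ?_⟩
  · rw [h, h3, natCast_eq_iff] at h1
    norm_num at h1
  · rw [h, h5, natCast_eq_iff] at h1
    norm_num at h1
  · rw [h, h5, natCast_eq_iff] at h3
    norm_num at h3
  · obtain ⟨n, hn, rfl⟩ := hf k (smul_eq_of_sq_smul hk (n := 1) (hz k))
    aesop
  · rw [pow_right_comm, sq, mul_smul, hz, hz]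

variable (Γ) in
theorem exists_type_1_1_1_1_4_4 (ha : a ^ 2 = -5) (hs : s ^ 2 = 3) :
    ∃ g ∈ geometric Γ a s, ∃ i j l m, i ≠ j ∧ i ≠ l ∧ i ≠ m ∧ j ≠ l ∧ j ≠ m ∧ l ≠ m ∧
      g • F.w i = F.w i ∧ g • F.w j = F.w j ∧ g • F.z l = F.z l ∧ g • F.z m = F.z m ∧
      (∀ k, g ^ 2 • F.z k = F.z k → k = i ∨ k = j ∨ k = l ∨ k = m) ∧
      ∀ k, g ^ 4 • F.z k = F.z k := by
  have : Fact (Nat.Prime 23) := ⟨by norm_num⟩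
  have D : FrobData 23 8 15 4 [14, 5, 13, 6] := ⟨by norm_num, by norm_num, by norm_num, by norm_num,
    by decide +kernel, by decide +kernel⟩
  obtain ⟨ψ, g, e, H, hga, hz, he, hf⟩ := D.exists (Γ := Γ) F ha
  obtain ⟨h1, h2⟩ := he 14 (by simp)
  obtain ⟨h3, h4⟩ := he 5 (by simp)
  obtain ⟨h5, h6⟩ := he 13 (by simp)
  obtain ⟨h7, h8⟩ := he 6 (by simp)
  refine ⟨g, mem_geometric.2 ⟨hga, H.smul_sqrt_three (c := 7) hs D.ne_two
    (by norm_num) (by norm_num)⟩, e 14, e 5, e 13, e 6, fun h => ?_, fun h => ?_, fun h => ?_,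
    fun h => ?_, fun h => ?_, fun h => ?_, H.smul_w_eq_self (c := 1) D.ne_two h2 h1 (by norm_num)
    (by norm_num), H.smul_w_eq_self (c := 5) D.ne_two h4 h3 (by norm_num)
    (by norm_num), h6, h8, fun k hk => ?_, hz⟩
  · rw [h, h3, natCast_eq_iff] at h1
    norm_num at h1
  · rw [h, h5, natCast_eq_iff] at h1
    norm_num at h1
  · rw [h, h7, natCast_eq_iff] at h1
    norm_num at h1
  · rw [h, h5, natCast_eq_iff] at h3
    norm_num at h3
  · rw [h, h7, natCast_eq_iff] at h3
    norm_num at h3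
  · rw [h, h7, natCast_eq_iff] at h5
    norm_num at h5
  · have hd := H.dodecic_map (F.dodecic_z k)
    have ht := evalList_tail 23 8 15 (ψ (F.z k)) hd
    have hq := H.frob_pow 2 (F.z k)
    rw [hk, ← evalList_frob (by norm_num) ht (by rw [length_tail]; norm_num)] at hq
    have hv := (mulMod_spec (p := 23) ht [15, 9, 1, 0, 7, 22, 4, 14]
      (v := frob 23 (tail 23 8 15) 2) (by decide +kernel)).2
    have hl : mulMod 23 (tail 23 8 15) [15, 9, 1, 0, 7, 22, 4, 14] (frob 23 (tail 23 8 15) 2) =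
      [9, 9, 12, 9, 1, 7, 22, 4, 14, 0, 0, 0] := by decide +kernel
    rw [← hq, hl] at hv
    have h23 : (23 : AlgebraicClosure (ZMod 23)) = 0 := by
      exact_mod_cast CharP.cast_eq_zero (AlgebraicClosure (ZMod 23)) 23
    generalize hα : ψ (F.z k) = α at hv
    have hr : (α - 14) * ((α - 5) * ((α - 13) * (α - 6))) = 0 := by
      simp only [evalList] at hv
      push_cast at hv
      linear_combination hv + (237 - 122 * α + 22 * α ^ 2 - 2 * α ^ 3) * h23
    have hinj := H.injective F D.splits D.ne_zero
    simp only [mul_eq_zero, sub_eq_zero] at hr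
    obtain h | h | h | h := hr
    · exact Or.inl (hinj (hα.trans (h.trans (h1.trans (by norm_num)).symm)))
    · exact Or.inr (Or.inl (hinj (hα.trans (h.trans (h3.trans (by norm_num)).symm))))
    · exact Or.inr (Or.inr (Or.inl (hinj (hα.trans (h.trans (h5.trans (by norm_num)).symm)))))
    · exact Or.inr (Or.inr (Or.inr (hinj (hα.trans (h.trans (h7.trans (by norm_num)).symm)))))

end Existence

end Elements

section LowerBound

variable {Γ α : Type*} [Group Γ] [MulAction Γ α] in
theorem conj_pow_smul_eq_iff {g h : Γ} (n : ℕ) (x : α) :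
    (h⁻¹ * g * h) ^ n • x = x ↔ g ^ n • h • x = h • x := by
  have : (h⁻¹ * g * h) ^ n = h⁻¹ * g ^ n * h := by simpa using conj_pow (a := h⁻¹) (b := g) (i := n)
  rw [this, mul_smul, mul_smul, inv_smul_eq_iff]

variable {Γ α : Type*} [Group Γ] [MulAction Γ α] in
theorem conj_smul_eq_iff {g h : Γ} {x y : α} :
    (h⁻¹ * g * h) • x = y ↔ g • h • x = h • y := by
  rw [mul_smul, mul_smul, inv_smul_eq_iff]

variable {Γ : Type*} [Group Γ] in
theorem conj_mem {g h : Γ} {H : Subgroup Γ} (hh : h ∈ H) (hg : g ∈ H) : h⁻¹ * g * h ∈ H :=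
  H.mul_mem (H.mul_mem (H.inv_mem hh) hg) hh

variable {S Γ : Type*} [CommRing S] [IsDomain S] [Algebra ℤ[X] S] [FaithfulSMul ℤ[X] S]
  [Group Γ] [Finite Γ] [MulSemiringAction Γ S] [SMulCommClass Γ ℤ[X] S]
  [Algebra.IsInvariant ℤ[X] S Γ] {a s : S} {g h : Γ}
  (F : Factorization a (algebraMap ℤ[X] S X)) (ha : a ^ 2 = -5) (hs : s ^ 2 = 3)

omit [IsDomain S] in
theorem charZero_of_faithfulSMul : CharZero S :=
  charZero_of_injective_ringHom (FaithfulSMul.algebraMap_injective ℤ[X] S)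

namespace Factorization

include ha

omit [Finite Γ] [SMulCommClass Γ ℤ[X] S] [Algebra.IsInvariant ℤ[X] S Γ] in
theorem z_ne_zero (i : Fin 12) : F.z i ≠ 0 := fun h => by
  have := charZero_of_faithfulSMul (S := S)
  have h1 := F.dodecic_z i
  rw [h] at h1
  have h2 : (-(625 * (6399 - 648 * a))) ^ 3 = 0 := by
    rw [← h1, dodecic, quartic]
    ring
  have h3 : (648 * a) ^ 2 = 6399 ^ 2 := by
    have := pow_eq_zero_iff three_ne_zero |>.1 h2
    rw [neg_eq_zero, mul_eq_zero, sub_eq_zero] at this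
    rw [this.resolve_left (by norm_num)]
  rw [mul_pow, ha] at h3
  have h4 : ((648 ^ 2 * 5 + 6399 ^ 2 : ℕ) : S) = 0 := by
    push_cast
    linear_combination -h3
  exact absurd h4 (Nat.cast_ne_zero.2 (by norm_num))

theorem w_ne_zero (i : Fin 12) : F.w i ≠ 0 := fun h => by
  have := charZero_of_faithfulSMul (S := S)
  have h1 := F.w_sq i
  rw [h] at h1
  simp at h1
  exact F.z_ne_zero ha i h1

variable (Γ) in
include Γ in
theorem z_injective : Function.Injective F.z := by
  have : Fact (Nat.Prime 23) := ⟨by norm_num⟩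
  obtain ⟨ψ, g, H⟩ := exists_isSpecialization Γ ha 23 8 6 (by norm_num)
  exact Function.Injective.of_comp (f := ψ)
    (H.injective F (k := 8) (by decide +kernel) (by norm_num))

omit ha
variable {F}

theorem exists_smul_z (hg : g • a = a) (i : Fin 12) : ∃ j, g • F.z i = F.z j := by
  obtain ⟨j, hj⟩ := F.exists_z (smul_dodecic hg (F.dodecic_z i))
  exact ⟨j, hj.symm⟩

theorem smul_w_eq_or {i j : Fin 12} (h : g • F.z i = F.z j) :
    g • F.w i = F.w j ∨ g • F.w i = -F.w j := by
  apply sq_eq_sq_iff_eq_or_eq_neg.1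
  rw [← smul_pow', F.w_sq, F.w_sq, smul_mul', smul_ofNat, h]

theorem smul_z_of_smul_w {i j : Fin 12} (h : g • F.w i = F.w j ∨ g • F.w i = -F.w j) :
    g • F.z i = F.z j := by
  have := charZero_of_faithfulSMul (S := S)
  have h1 := sq_eq_sq_iff_eq_or_eq_neg.2 h
  rw [← smul_pow', F.w_sq, F.w_sq, smul_mul', smul_ofNat] at h1
  exact mul_left_cancel₀ (by norm_num) h1

theorem smul_z_eq_self {i : Fin 12} (h : g • F.w i = F.w i) : g • F.z i = F.z i :=
  smul_z_of_smul_w (Or.inl h)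

end Factorization

include F ha hs

open Factorization MulAction

theorem ncard_orbit_z_and_exists (i : Fin 12) : (orbit (geometric Γ a s) (F.z i)).ncard = 12 ∧
    ∀ j, ∃ g ∈ geometric Γ a s, g • F.z i = F.z j := by
  have hinj := F.z_injective Γ ha
  have hsub : orbit (geometric Γ a s) (F.z i) ⊆ F.z '' (Finset.univ : Finset (Fin 12)) := by
    rintro _ ⟨⟨g, hg⟩, rfl⟩
    obtain ⟨k, hk⟩ := exists_smul_z (F := F) hg.1 i
    exact ⟨k, Finset.mem_coe.2 (Finset.mem_univ k), hk.symm⟩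
  have hle := ncard_orbit_le hsub
  have hpos := ncard_orbit_pos (H := geometric Γ a s) (x := F.z i)
  have h11 : Fact (Nat.Prime 11) := ⟨by norm_num⟩
  obtain ⟨-, g, hg, i₀, -, hf, h11z, -⟩ := exists_type_1_11 Γ F ha hs
  obtain ⟨g', hg', hf', h8⟩ := exists_type_4_8 Γ F ha hs
  have e1 := ncard_orbit_modEq hg (x := F.z i) (p := 11) (n := 1) (by
    intro x hx
    obtain ⟨k, -, rfl⟩ := hsub hx
    exact h11z k)
  have e2 := dvd_ncard_orbit hg' (x := F.z i) (p := 2) (n := 3) (by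
    intro x hx
    obtain ⟨k, -, rfl⟩ := hsub hx
    exact h8 k) (by
    intro x hx
    obtain ⟨k, -, rfl⟩ := hsub hx
    exact hf' k)
  have e3 : {y ∈ orbit (geometric Γ a s) (F.z i) | g • y = y}.ncard ≤ 1 := by
    rw [← Set.ncard_singleton (F.z i₀)]
    refine Set.ncard_le_ncard ?_
    rintro y ⟨hy, hgy⟩
    obtain ⟨k, -, rfl⟩ := hsub hy
    rw [hf k hgy]
    rfl
  rw [Finset.card_fin] at hle
  have h12 : (orbit (geometric Γ a s) (F.z i)).ncard = 12 := by
    unfold Nat.ModEq at e1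
    obtain e3 | e3 := Nat.le_one_iff_eq_zero_or_eq_one.1 e3 <;> rw [e3] at e1 <;> omega
  exact ⟨h12, fun j => exists_smul_eq_of_card_le hsub (by rw [h12, Finset.card_fin])
    (Finset.mem_univ j)⟩

theorem exists_smul_z_eq (i j : Fin 12) : ∃ g ∈ geometric Γ a s, g • F.z i = F.z j :=
  (ncard_orbit_z_and_exists F ha hs i).2 j

theorem exists_smul_w_eq_neg (i : Fin 12) : ∃ g ∈ geometric Γ a s, g • F.w i = -F.w i := by
  obtain ⟨g, hg, -, j, -, -, h1, -⟩ := exists_type_1_1_2_8 Γ F ha hs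
  obtain ⟨h, hh, h2⟩ := exists_smul_z_eq (Γ := Γ) F ha hs i j
  refine ⟨h⁻¹ * g * h, conj_mem hh hg, ?_⟩
  rw [conj_smul_eq_iff]
  obtain h3 | h3 := smul_w_eq_or h2
  · rw [smul_neg, h3, h1]
  · rw [smul_neg, h3, smul_neg, h1]

theorem exists_smul_w_eq (i j : Fin 12) : ∃ g ∈ geometric Γ a s, g • F.w i = F.w j := by
  obtain ⟨h, hh, h2⟩ := exists_smul_z_eq (Γ := Γ) F ha hs i j
  obtain h3 | h3 := smul_w_eq_or h2
  · exact ⟨h, hh, h3⟩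
  · obtain ⟨k, hk, h4⟩ := exists_smul_w_eq_neg (Γ := Γ) F ha hs j
    exact ⟨k * h, mul_mem hk hh, by rw [mul_smul, h3, smul_neg, h4, neg_neg]⟩

variable {F} in
omit hs in
theorem eq_of_smul_z_eq {i j k : Fin 12} (hi : g • F.z i = F.z k) (hj : g • F.z j = F.z k) :
    i = j :=
  F.z_injective Γ ha (smul_left_cancel g (hi.trans hj.symm))

omit [SMulCommClass Γ ℤ[X] S] [FaithfulSMul ℤ[X] S] [Algebra.IsInvariant ℤ[X] S Γ]
  [Finite Γ] F ha hs in
theorem conj_mem_stabilizer {x y : S} (hg : g • y = y) (hh : h • x = y) :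
    h⁻¹ * g * h ∈ stabilizer Γ x := by
  rw [mem_stabilizer_iff, conj_smul_eq_iff, hh, hg]

omit ha hs in
theorem conj_smul_w_eq_iff (n : ℕ) {k k' : Fin 12} (hk : h • F.z k = F.z k') :
    (h⁻¹ * g * h) ^ n • F.w k = F.w k ↔ g ^ n • F.w k' = F.w k' := by
  rw [conj_pow_smul_eq_iff]
  obtain h3 | h3 := smul_w_eq_or hk
  · rw [h3]
  · rw [h3, smul_neg, neg_inj]

omit hs in
theorem orbit_w_subset {i j : Fin 12} (hij : i ≠ j) :
    orbit (geometric Γ a s ⊓ stabilizer Γ (F.w i) : Subgroup Γ) (F.w j) ⊆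
      (fun b : Fin 12 × Bool => if b.2 then F.w b.1 else -F.w b.1) ''
        ((Finset.univ.erase i ×ˢ Finset.univ : Finset (Fin 12 × Bool)) : Set (Fin 12 × Bool)) := by
  rintro _ ⟨⟨g, hg, hgi⟩, rfl⟩
  obtain ⟨k, hk⟩ := exists_smul_z (F := F) hg.1 j
  have hki : k ≠ i := by
    rintro rfl
    exact hij (eq_of_smul_z_eq ha (smul_z_eq_self hgi) hk)
  obtain h3 | h3 := smul_w_eq_or hk
  · exact ⟨(k, true), by simpa using hki, h3.symm⟩
  · exact ⟨(k, false), by simpa using hki, h3.symm⟩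

theorem dvd_ncard_orbit_w (hg : g ∈ geometric Γ a s) {i₀ : Fin 12} (h0 : g • F.w i₀ = F.w i₀)
    (hf : ∀ k, g • F.w k = F.w k → k = i₀) {p n : ℕ} [Fact p.Prime]
    (hp : ∀ k, g ^ p ^ n • F.w k = F.w k) {i j : Fin 12} (hij : i ≠ j) :
    p ∣ (orbit (geometric Γ a s ⊓ stabilizer Γ (F.w i) : Subgroup Γ) (F.w j)).ncard := by
  obtain ⟨h, hh, h2⟩ := exists_smul_w_eq (Γ := Γ) F ha hs i i₀
  refine dvd_ncard_orbit (H := geometric Γ a s ⊓ stabilizer Γ (F.w i)) (g := h⁻¹ * g * h) (n := n)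
    ⟨conj_mem hh hg, conj_mem_stabilizer h0 h2⟩ ?_ ?_
  · intro y hy
    obtain ⟨⟨k, b⟩, -, rfl⟩ := orbit_w_subset F ha hij hy
    obtain ⟨k', hk'⟩ := exists_smul_z (F := F) hh.1 k
    have := (conj_smul_w_eq_iff F (g := g) (p ^ n) hk').2 (hp k')
    cases b <;> simpa using this
  · intro y hy hy'
    obtain ⟨⟨k, b⟩, hk, rfl⟩ := orbit_w_subset F ha hij hy
    obtain ⟨k', hk'⟩ := exists_smul_z (F := F) hh.1 k
    have h3 : (h⁻¹ * g * h) ^ 1 • F.w k = F.w k := by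
      cases b <;> simpa using hy'
    rw [conj_smul_w_eq_iff F 1 hk', pow_one] at h3
    rw [hf k' h3] at hk'
    have := eq_of_smul_z_eq ha hk' (smul_z_of_smul_w (Or.inl h2))
    simp_all

theorem ncard_orbit_w {i j : Fin 12} (hij : i ≠ j) :
    22 ≤ (orbit (geometric Γ a s ⊓ stabilizer Γ (F.w i) : Subgroup Γ) (F.w j)).ncard := by
  have := charZero_of_faithfulSMul (S := S)
  have h11 : Fact (Nat.Prime 11) := ⟨by norm_num⟩
  obtain ⟨-, g, hg, i₀, h0, hf, -, h11w⟩ := exists_type_1_11 Γ F ha hs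
  obtain ⟨g', hg', i', j', h0', -, hj, hf', h16⟩ := exists_type_1_1_2_8 Γ F ha hs
  have e1 := dvd_ncard_orbit_w F ha hs hg h0 (fun k hk => hf k (smul_z_eq_self hk))
    (p := 11) (n := 1) h11w hij
  have e2 := dvd_ncard_orbit_w F ha hs hg' h0' (fun k hk => by
    refine (hf' k (smul_z_eq_self hk)).resolve_right ?_
    rintro rfl
    rw [hj, neg_eq_self] at hk
    exact F.w_ne_zero ha _ hk) (p := 2) (n := 4) h16 hij
  exact Nat.le_of_dvd ncard_orbit_pos (Nat.Coprime.mul_dvd_of_dvd_of_dvd (by norm_num) e2 e1)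

theorem exists_smul_w_eq_and {i j k l : Fin 12} (hij : i ≠ j) (hkl : k ≠ l) :
    ∃ g ∈ geometric Γ a s, g • F.w i = F.w k ∧ g • F.w j = F.w l := by
  obtain ⟨h, hh, h2⟩ := exists_smul_w_eq (Γ := Γ) F ha hs i k
  obtain ⟨l', hl'⟩ := exists_smul_z (F := F) (Subgroup.inv_mem _ hh).1 l
  have hl : l' ≠ i := by
    rintro rfl
    refine hkl (eq_of_smul_z_eq ha (g := h⁻¹) ?_ hl')
    rw [inv_smul_eq_iff, smul_z_of_smul_w (Or.inl h2)]
  have hB : ∀ b, (l', b) ∈ (Finset.univ.erase i ×ˢ Finset.univ : Finset (Fin 12 × Bool)) :=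
    fun b => by simpa using hl
  have hc : (Finset.univ.erase i ×ˢ Finset.univ : Finset (Fin 12 × Bool)).card ≤
      (orbit (geometric Γ a s ⊓ stabilizer Γ (F.w i) : Subgroup Γ) (F.w j)).ncard := by
    rw [Finset.card_product, Finset.card_erase_of_mem (Finset.mem_univ i)]
    exact ncard_orbit_w F ha hs hij
  obtain ⟨g, ⟨hg, hgi⟩, hgj⟩ : ∃ g ∈ geometric Γ a s ⊓ stabilizer Γ (F.w i),
      g • F.w j = h⁻¹ • F.w l := by
    obtain h3 | h3 := smul_w_eq_or hl'
    · exact h3 ▸ exists_smul_eq_of_card_le (orbit_w_subset F ha hij) hc (hB true)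
    · exact h3 ▸ exists_smul_eq_of_card_le (orbit_w_subset F ha hij) hc (hB false)
  refine ⟨h * g, mul_mem hh hg, ?_, ?_⟩
  · rw [mul_smul, hgi, h2]
  · rw [mul_smul, hgj, smul_inv_smul]

variable (Γ) in
/-- The stabilizer of the square roots `F.w i`, `F.w j` in the geometric Galois group. -/
def pairStabilizer (s : S) (i j : Fin 12) : Subgroup Γ :=
  geometric Γ a s ⊓ stabilizer Γ (F.w i) ⊓ stabilizer Γ (F.w j)

omit hs in
theorem orbit_z_subset {i j l : Fin 12} (hil : i ≠ l) (hjl : j ≠ l) :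
    orbit (pairStabilizer Γ F s i j) (F.z l) ⊆
      F.z '' ((Finset.univ.erase i).erase j : Finset (Fin 12)) := by
  rintro _ ⟨⟨g, ⟨hg, hgi⟩, hgj⟩, rfl⟩
  obtain ⟨k, hk⟩ := exists_smul_z (F := F) hg.1 l
  refine ⟨k, ?_, hk.symm⟩
  rw [Finset.mem_coe, Finset.mem_erase, Finset.mem_erase]
  refine ⟨?_, ?_, Finset.mem_univ k⟩
  · rintro rfl
    exact hjl (eq_of_smul_z_eq ha (smul_z_eq_self hgj) hk)
  · rintro rfl
    exact hil (eq_of_smul_z_eq ha (smul_z_eq_self hgi) hk)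

theorem ncard_orbit_z_pair {i j l : Fin 12} (hij : i ≠ j) (hil : i ≠ l) (hjl : j ≠ l) :
    (orbit (pairStabilizer Γ F s i j) (F.z l)).ncard = 10 := by
  have hsub := orbit_z_subset (Γ := Γ) (s := s) F ha hil hjl
  have hle := ncard_orbit_le hsub
  have hpos := ncard_orbit_pos (H := pairStabilizer Γ F s i j) (x := F.z l)
  have h5 : Fact (Nat.Prime 5) := ⟨by norm_num⟩
  have h3 : Fact (Nat.Prime 3) := ⟨by norm_num⟩
  rw [Finset.card_erase_of_mem (by simpa using hij.symm),
    Finset.card_erase_of_mem (Finset.mem_univ i), Finset.card_fin] at hle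
  have e1 : 5 ∣ (orbit (pairStabilizer Γ F s i j) (F.z l)).ncard := by
    obtain ⟨g, hg, i₀, j₀, h0, hi₀, hj₀, hf, hp⟩ := exists_type_1_1_5_5 Γ F ha hs
    obtain ⟨h, hh, hi, hj⟩ := exists_smul_w_eq_and (Γ := Γ) F ha hs hij h0
    refine dvd_ncard_orbit (H := pairStabilizer Γ F s i j) (g := h⁻¹ * g * h) (n := 1)
        ⟨⟨conj_mem hh hg,
      conj_mem_stabilizer hi₀ hi⟩, conj_mem_stabilizer hj₀ hj⟩ ?_ ?_
    · intro y hy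
      obtain ⟨k, -, rfl⟩ := hsub hy
      obtain ⟨k', hk'⟩ := exists_smul_z (F := F) hh.1 k
      rw [conj_pow_smul_eq_iff, hk']
      exact hp k'
    · intro y hy hy'
      obtain ⟨k, hk, rfl⟩ := hsub hy
      obtain ⟨k', hk'⟩ := exists_smul_z (F := F) hh.1 k
      rw [conj_smul_eq_iff, hk'] at hy'
      obtain rfl | rfl := hf k' hy'
      · have := eq_of_smul_z_eq ha hk' (smul_z_of_smul_w (Or.inl hi))
        simp_all
      · have := eq_of_smul_z_eq ha hk' (smul_z_of_smul_w (Or.inl hj))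
        simp_all
  obtain ⟨g, hg, i₀, j₀, l₀, h0, -, -, hi₀, hj₀, -, hf, hp⟩ := exists_type_1_1_1_3_3_3 Γ F ha hs
  obtain ⟨h, hh, hi, hj⟩ := exists_smul_w_eq_and (Γ := Γ) F ha hs hij h0
  have e2 := ncard_orbit_modEq (H := pairStabilizer Γ F s i j) (x := F.z l) (g := h⁻¹ * g * h)
    (p := 3) (n := 1) ⟨⟨conj_mem hh hg,
      conj_mem_stabilizer hi₀ hi⟩, conj_mem_stabilizer hj₀ hj⟩ (by
    intro y hy
    obtain ⟨k, -, rfl⟩ := hsub hy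
    obtain ⟨k', hk'⟩ := exists_smul_z (F := F) hh.1 k
    rw [conj_pow_smul_eq_iff, hk']
    exact hp k')
  have e3 : {y ∈ orbit (pairStabilizer Γ F s i j) (F.z l) |
      (h⁻¹ * g * h) • y = y}.ncard ≤ 1 := by
    rw [← Set.ncard_singleton (h⁻¹ • F.z l₀)]
    refine Set.ncard_le_ncard ?_
    rintro y ⟨hy, hgy⟩
    obtain ⟨k, hk, rfl⟩ := hsub hy
    obtain ⟨k', hk'⟩ := exists_smul_z (F := F) hh.1 k
    rw [conj_smul_eq_iff, hk'] at hgy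
    obtain rfl | rfl | rfl := hf k' hgy
    · have := eq_of_smul_z_eq ha hk' (smul_z_of_smul_w (Or.inl hi))
      simp_all
    · have := eq_of_smul_z_eq ha hk' (smul_z_of_smul_w (Or.inl hj))
      simp_all
    · rw [Set.mem_singleton_iff, ← hk', inv_smul_smul]
  unfold Nat.ModEq at e2
  obtain e3 | e3 := Nat.le_one_iff_eq_zero_or_eq_one.1 e3 <;> rw [e3] at e2 <;> omega

theorem exists_smul_triple {i j l i₀ j₀ l₀ : Fin 12} (hij : i ≠ j) (hil : i ≠ l) (hjl : j ≠ l)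
    (hij₀ : i₀ ≠ j₀) (hil₀ : i₀ ≠ l₀) (hjl₀ : j₀ ≠ l₀) : ∃ g ∈ geometric Γ a s,
      g • F.w i = F.w i₀ ∧ g • F.w j = F.w j₀ ∧ g • F.z l = F.z l₀ := by
  obtain ⟨h, hh, hi, hj⟩ := exists_smul_w_eq_and (Γ := Γ) F ha hs hij hij₀
  obtain ⟨k, hk⟩ := exists_smul_z (F := F) (Subgroup.inv_mem _ hh).1 l₀
  have hki : k ≠ i := by
    rintro rfl
    refine hil₀ (eq_of_smul_z_eq ha (g := h⁻¹) ?_ hk)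
    rw [inv_smul_eq_iff, smul_z_of_smul_w (Or.inl hi)]
  have hkj : k ≠ j := by
    rintro rfl
    refine hjl₀ (eq_of_smul_z_eq ha (g := h⁻¹) ?_ hk)
    rw [inv_smul_eq_iff, smul_z_of_smul_w (Or.inl hj)]
  obtain ⟨g, ⟨⟨hg, hgi⟩, hgj⟩, hgl⟩ := exists_smul_eq_of_card_le (b := k)
    (orbit_z_subset (Γ := Γ) (s := s) F ha hil hjl) (by
      rw [ncard_orbit_z_pair F ha hs hij hil hjl,
          Finset.card_erase_of_mem (by simpa using hij.symm),
        Finset.card_erase_of_mem (Finset.mem_univ i), Finset.card_fin]) (by simp [hki, hkj])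
  refine ⟨h * g, mul_mem hh hg, ?_, ?_, ?_⟩
  · rw [mul_smul, hgi, hi]
  · rw [mul_smul, hgj, hj]
  · rw [mul_smul, hgl, ← hk, smul_inv_smul]

variable (Γ) in
/-- The lower bound for the order of the geometric Galois group. -/
theorem le_card_geometric : 190080 ≤ Nat.card (geometric Γ a s) := by
  have := charZero_of_faithfulSMul (S := S)
  obtain ⟨g, hg, i, j, l, m, hij, hil, him, hjl, hjm, hlm, hi, hj, hl, hm, hf, h4⟩ :=
    exists_type_1_1_1_1_4_4 Γ F ha hs
  let G₃ : Subgroup Γ := pairStabilizer Γ F s i j ⊓ stabilizer Γ (F.z l)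
  have hsub : orbit G₃ (F.z m) ⊆ F.z '' (((Finset.univ.erase i).erase j).erase l : Finset _) := by
    rintro _ ⟨⟨h, hh, hhl⟩, rfl⟩
    obtain ⟨k, hk, hk'⟩ := orbit_z_subset F ha him hjm
        (mem_orbit (F.z m) (⟨h, hh⟩ : pairStabilizer Γ F s i j))
    refine ⟨k, ?_, hk'⟩
    rw [Finset.mem_coe, Finset.mem_erase]
    refine ⟨?_, hk⟩
    rintro rfl
    exact hlm (eq_of_smul_z_eq ha hhl hk'.symm)
  have hgG : g ∈ G₃ := ⟨⟨⟨hg, hi⟩, hj⟩, hl⟩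
  have h9 : (orbit G₃ (F.z m)).ncard = 9 := by
    have hle := ncard_orbit_le hsub
    have hpos := ncard_orbit_pos (H := G₃) (x := F.z m)
    have h3 : Fact (Nat.Prime 3) := ⟨by norm_num⟩
    rw [Finset.card_erase_of_mem (by simp [hil.symm, hjl.symm]),
      Finset.card_erase_of_mem (by simpa using hij.symm),
      Finset.card_erase_of_mem (Finset.mem_univ i), Finset.card_fin] at hle
    have e1 : 3 ∣ (orbit G₃ (F.z m)).ncard := by
      obtain ⟨g', hg', i₀, j₀, l₀, h1, h2, h3, hi₀, hj₀, hl₀, hf', hp⟩ :=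
        exists_type_1_1_1_3_3_3 Γ F ha hs
      obtain ⟨h, hh, hi', hj', hl'⟩ := exists_smul_triple (Γ := Γ) F ha hs hij hil hjl h1 h2 h3
      refine dvd_ncard_orbit (H := G₃) (g := h⁻¹ * g' * h) (n := 1) ⟨⟨⟨conj_mem hh hg',
        conj_mem_stabilizer hi₀ hi'⟩, conj_mem_stabilizer hj₀ hj'⟩,
        conj_mem_stabilizer hl₀ hl'⟩ ?_ ?_
      · intro y hy
        obtain ⟨k, -, rfl⟩ := hsub hy
        obtain ⟨k', hk'⟩ := exists_smul_z (F := F) hh.1 k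
        rw [conj_pow_smul_eq_iff, hk']
        exact hp k'
      · intro y hy hy'
        obtain ⟨k, hk, rfl⟩ := hsub hy
        obtain ⟨k', hk'⟩ := exists_smul_z (F := F) hh.1 k
        rw [conj_smul_eq_iff, hk'] at hy'
        obtain rfl | rfl | rfl := hf' k' hy'
        · have := eq_of_smul_z_eq ha hk' (smul_z_of_smul_w (Or.inl hi'))
          simp_all
        · have := eq_of_smul_z_eq ha hk' (smul_z_of_smul_w (Or.inl hj'))
          simp_all
        · have := eq_of_smul_z_eq ha hk' hl'
          simp_all
    have e2 : 4 ∣ (orbit G₃ (F.z m) \ {F.z m}).ncard := by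
      refine four_dvd_ncard (g := g) ((finite_orbit _ _).subset Set.sdiff_subset) ?_ ?_ ?_
      · rintro y ⟨hy, hym⟩
        refine ⟨smul_mem_orbit hgG hy, fun h => hym ?_⟩
        exact smul_left_cancel g (h.trans hm.symm)
      · rintro y ⟨hy, -⟩
        obtain ⟨k, -, rfl⟩ := hsub hy
        exact h4 k
      · rintro y ⟨hy, hym⟩ h
        obtain ⟨k, hk, rfl⟩ := hsub hy
        have := hf k h
        simp_all
    rw [Set.ncard_sdiff_singleton_of_mem (mem_orbit_self _)] at e2
    omega
  have h4' : 4 ≤ Nat.card (G₃ ⊓ stabilizer Γ (F.z m) : Subgroup Γ) := by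
    obtain ⟨k, hk⟩ : ∃ k : Fin 12, k ∉ ({i, j, l, m} : Finset (Fin 12)) := by
      by_contra! h
      have h1 : (Finset.univ : Finset (Fin 12)) ⊆ {i, j, l, m} := fun k _ => h k
      have h2 := (Finset.card_le_card h1).trans Finset.card_le_four
      norm_num at h2
    rw [card_eq_ncard_orbit_mul _ (F.z k)]
    refine (Nat.le_of_dvd ncard_orbit_pos (four_dvd_ncard (finite_orbit _ _) (g := g)
      (fun x hx => smul_mem_orbit (g := g) (Subgroup.mem_inf.2 ⟨hgG, hm⟩) hx) ?_ ?_)).trans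
      (Nat.le_mul_of_pos_right _ Nat.card_pos)
    · rintro _ ⟨⟨h, ⟨⟨⟨hh, _⟩, _⟩, _⟩, _⟩, rfl⟩
      obtain ⟨k', hk'⟩ := exists_smul_z (F := F) hh.1 k
      exact (congrArg (g ^ 4 • ·) hk').trans ((h4 k').trans hk'.symm)
    · rintro _ ⟨⟨h, ⟨⟨⟨hh, hhi⟩, hhj⟩, hhl⟩, hhm⟩, rfl⟩ h2
      obtain ⟨k', hk'⟩ := exists_smul_z (F := F) hh.1 k
      refine hk ?_
      have h3 : g ^ 2 • F.z k' = F.z k' := by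
        rw [← hk']
        exact h2
      rw [Finset.mem_insert, Finset.mem_insert, Finset.mem_insert, Finset.mem_singleton]
      obtain rfl | rfl | rfl | rfl := hf k' h3
      · exact Or.inl (eq_of_smul_z_eq ha hk' (smul_z_eq_self hhi))
      · exact Or.inr (Or.inl (eq_of_smul_z_eq ha hk' (smul_z_eq_self hhj)))
      · exact Or.inr (Or.inr (Or.inl (eq_of_smul_z_eq ha hk' hhl)))
      · exact Or.inr (Or.inr (Or.inr (eq_of_smul_z_eq ha hk' hhm)))
  have h10 := ncard_orbit_z_pair F ha hs (Γ := Γ) hij hil hjl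
  have h22 := ncard_orbit_w F ha hs (Γ := Γ) hij
  have h2 : 2 ≤ (orbit (geometric Γ a s ⊓ stabilizer Γ (F.z i) : Subgroup Γ) (F.w i)).ncard := by
    obtain ⟨h, hh, h1⟩ := exists_smul_w_eq_neg F ha hs (Γ := Γ) i
    refine two_le_ncard_orbit ⟨hh, smul_z_of_smul_w (Or.inr h1)⟩ ?_
    rw [h1, Ne, neg_eq_self]
    exact F.w_ne_zero ha i
  have hle : Nat.card (geometric Γ a s ⊓ stabilizer Γ (F.w i) : Subgroup Γ) ≤
      Nat.card (geometric Γ a s ⊓ stabilizer Γ (F.z i) ⊓ stabilizer Γ (F.w i) : Subgroup Γ) :=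
    Subgroup.card_le_of_le fun h hh => ⟨⟨hh.1, smul_z_eq_self hh.2⟩, hh.2⟩
  calc 190080 = 12 * (2 * (22 * (10 * (9 * 4)))) := by norm_num
    _ ≤ 12 * (2 * (22 * (10 * (9 * Nat.card (G₃ ⊓ stabilizer Γ (F.z m) : Subgroup Γ))))) := by
      gcongr
    _ = 12 * (2 * (22 * Nat.card (pairStabilizer Γ F s i j))) := by
      rw [card_eq_ncard_orbit_mul (pairStabilizer Γ F s i j) (F.z l), h10, ← h9,
        ← card_eq_ncard_orbit_mul G₃]
    _ ≤ 12 * (2 * Nat.card (geometric Γ a s ⊓ stabilizer Γ (F.w i) : Subgroup Γ)) := by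
      rw [card_eq_ncard_orbit_mul (geometric Γ a s ⊓ stabilizer Γ (F.w i)) (F.w j), pairStabilizer]
      gcongr
    _ ≤ Nat.card (geometric Γ a s) := by
      rw [card_eq_ncard_orbit_mul (geometric Γ a s) (F.z i), (ncard_orbit_z_and_exists F ha hs i).1,
        card_eq_ncard_orbit_mul (geometric Γ a s ⊓ stabilizer Γ (F.z i)) (F.w i)]
      gcongr

variable (Γ) in
theorem le_card : 760320 ≤ Nat.card Γ := by
  have := charZero_of_faithfulSMul (S := S)
  have ha0 : a ≠ 0 := by
    rintro rfl
    norm_num at ha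
  have hs0 : s ≠ 0 := by
    rintro rfl
    norm_num at hs
  obtain ⟨g, hg⟩ := exists_smul_eq_neg Γ ha
  obtain ⟨⟨h, hha, hhs⟩, -⟩ := exists_type_1_11 Γ F ha hs
  have h1 : 2 ≤ (orbit (⊤ : Subgroup Γ) a).ncard :=
    two_le_ncard_orbit (Subgroup.mem_top g) (by rwa [hg, Ne, neg_eq_self])
  have h2 : 2 ≤ (orbit (⊤ ⊓ stabilizer Γ a : Subgroup Γ) s).ncard :=
    two_le_ncard_orbit (g := h) ⟨Subgroup.mem_top h, hha⟩ (by rwa [hhs, Ne, neg_eq_self])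
  calc 760320 = 2 * (2 * 190080) := by norm_num
    _ ≤ 2 * (2 * Nat.card (geometric Γ a s)) := by
      gcongr
      exact le_card_geometric Γ F ha hs
    _ = 2 * (2 * Nat.card (⊤ ⊓ stabilizer Γ a ⊓ stabilizer Γ s : Subgroup Γ)) := by
      rw [top_inf_eq, geometric]
    _ ≤ Nat.card Γ := by
      rw [← Subgroup.card_top (G := Γ), card_eq_ncard_orbit_mul ⊤ a,
        card_eq_ncard_orbit_mul (⊤ ⊓ stabilizer Γ a) s]
      gcongr

end LowerBound

section Correspondence

variable {R : Type*} [CommRing R]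

/-- The part of `num` free of `√-5`. -/
def numRe (x y : R) : R :=
  (661533328125 * y)
    + (1987686843750 + 290005312500 * y + 12824325000 * y ^ 2 + 361941750 * y ^ 3
        + 7404750 * y ^ 4 + 53100 * y ^ 5 + 118 * y ^ 6) * x
    + (22942996875 * y + 2512417500 * y ^ 2 + 59296050 * y ^ 3 + 382860 * y ^ 4
        + 708 * y ^ 5) * x ^ 2
    + (897216750 * y + 75597300 * y ^ 2 + 692550 * y ^ 3 + 1656 * y ^ 4) * x ^ 3
    + (16129125 * y + 612360 * y ^ 2 + 2106 * y ^ 3) * x ^ 4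
    + (109350 * y + 1458 * y ^ 2) * x ^ 5
    + (243 * y) * x ^ 6

/-- The coefficient of `√-5` in `num`. -/
def numIm (x y : R) : R :=
  (852519937500 * y)
    + (-155356734375 + 76317187500 * y + 8551321875 * y ^ 2 + 369083250 * y ^ 3 + 6411825 * y ^ 4
        + 42750 * y ^ 5 + 95 * y ^ 6) * x
    + (861131250 * y + 661162500 * y ^ 2 + 23943600 * y ^ 3 + 218160 * y ^ 4 + 570 * y ^ 5) * x ^ 2
    + (-37725750 * y + 11554650 * y ^ 2 + 182250 * y ^ 3 + 666 * y ^ 4) * x ^ 3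
    + (-218700 * y + 43740 * y ^ 2 + 324 * y ^ 3) * x ^ 4

/-- The part of `den` free of `√-5`. -/
def denRe (x y : R) : R :=
  (1419943921875 + 41518828125 * y + 1660753125 * y ^ 2 + 7381125 * y ^ 3)
    + (140275546875 + 14759971875 * y + 837327375 * y ^ 2 + 17607375 * y ^ 3 + 116910 * y ^ 4
        + 236 * y ^ 5) * x
    + (4052784375 + 1296496125 * y + 44669475 * y ^ 2 + 318735 * y ^ 3 + 630 * y ^ 4) * x ^ 2
    + (18012375 + 28947375 * y + 419985 * y ^ 2 + 1197 * y ^ 3) * x ^ 3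
    + (211410 * y + 1080 * y ^ 2) * x ^ 4
    + (486 * y) * x ^ 5

/-- The coefficient of `√-5` in `den`. -/
def denIm (x y : R) : R :=
  (373669453125 + 61447865625 * y + 1660753125 * y ^ 2 + 7381125 * y ^ 3)
    + (-13607240625 + 3884203125 * y + 455250375 * y ^ 2 + 10434825 * y ^ 3 + 79110 * y ^ 4
        + 190 * y ^ 5) * x
    + (-157190625 + 106282125 * y + 11755125 * y ^ 2 + 135675 * y ^ 3 + 396 * y ^ 4) * x ^ 2
    + (-698625 + 1816425 * y + 58725 * y ^ 2 + 315 * y ^ 3) * x ^ 3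
    + (7290 * y + 54 * y ^ 2) * x ^ 4

/-- Numerator of the algebraic expression of `√3` through the two sets of roots. -/
def num (a x y : R) : R := numRe x y + a * numIm x y

/-- Denominator of the algebraic expression of `√3` through the two sets of roots. -/
def den (a x y : R) : R := denRe x y + a * denIm x y

theorem map_num {R' F : Type*} [CommRing R'] [FunLike F R R'] [RingHomClass F R R'] (f : F)
    (a x y : R) : f (num a x y) = num (f a) (f x) (f y) := by
  simp only [num, numRe, numIm, map_add, map_mul, map_pow, map_ofNat, map_neg]

theorem map_den {R' F : Type*} [CommRing R'] [FunLike F R R'] [RingHomClass F R R'] (f : F)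
    (a x y : R) : f (den a x y) = den (f a) (f x) (f y) := by
  simp only [den, denRe, denIm, map_add, map_mul, map_pow, map_ofNat, map_neg]

theorem num_sq_re (x y : R) : 5 * (numRe x y ^ 2 - 5 * numIm x y ^ 2
      - 3 * x * y * (denRe x y ^ 2 - 5 * denIm x y ^ 2)) =
    295245 * ((x ^ 4 + 300 * x ^ 3 + 21750 * x ^ 2 + 27500 * x - 3999375) ^ 3
      - 15 * (x ^ 4 + 300 * x ^ 3 + 21750 * x ^ 2 + 27500 * x - 3999375)
        * (405000 - 2000 * x - 600 * x ^ 2) ^ 2) * y ^ 2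
    - (156005 * ((y ^ 4 + 300 * y ^ 3 + 21750 * y ^ 2 + 27500 * y - 3999375) ^ 3
      - 15 * (y ^ 4 + 300 * y ^ 3 + 21750 * y ^ 2 + 27500 * y - 3999375)
        * (405000 - 2000 * y - 600 * y ^ 2) ^ 2)
      - 560500 * (3 * (y ^ 4 + 300 * y ^ 3 + 21750 * y ^ 2 + 27500 * y - 3999375) ^ 2
        * (405000 - 2000 * y - 600 * y ^ 2) - 5 *
            (405000 - 2000 * y - 600 * y ^ 2) ^ 3)) * x ^ 2 := by
  simp only [numRe, numIm, denRe, denIm]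
  ring

theorem num_sq_im (x y : R) : 10 * (numRe x y * numIm x y - 3 * x * y * denRe x y * denIm x y) =
    295245 * (3 * (x ^ 4 + 300 * x ^ 3 + 21750 * x ^ 2 + 27500 * x - 3999375) ^ 2
        * (405000 - 2000 * x - 600 * x ^ 2) - 5 * (405000 - 2000 * x - 600 * x ^ 2) ^ 3) * y ^ 2
    - (-112100 * ((y ^ 4 + 300 * y ^ 3 + 21750 * y ^ 2 + 27500 * y - 3999375) ^ 3
      - 15 * (y ^ 4 + 300 * y ^ 3 + 21750 * y ^ 2 + 27500 * y - 3999375)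
        * (405000 - 2000 * y - 600 * y ^ 2) ^ 2)
      - 156005 * (3 * (y ^ 4 + 300 * y ^ 3 + 21750 * y ^ 2 + 27500 * y - 3999375) ^ 2
        * (405000 - 2000 * y - 600 * y ^ 2) - 5 *
            (405000 - 2000 * y - 600 * y ^ 2) ^ 3)) * x ^ 2 := by
  simp only [numRe, numIm, denRe, denIm]
  ring

end Correspondence

section Correspondence

variable {R : Type*} [CommRing R]

theorem num_sq {a t x y : R} (ha : a ^ 2 = -5) (hx : dodecic a t x = 0)
    (hy : dodecic (-a) t y = 0) : 5 * num a x y ^ 2 = 15 * x * y * den a x y ^ 2 := by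
  have e0 := num_sq_re x y
  have e1 := num_sq_im x y
  set x₀ := x ^ 4 + 300 * x ^ 3 + 21750 * x ^ 2 + 27500 * x - 3999375 with hx₀
  set x₁ := 405000 - 2000 * x - 600 * x ^ 2 with hx₁
  set y₀ := y ^ 4 + 300 * y ^ 3 + 21750 * y ^ 2 + 27500 * y - 3999375 with hy₀
  set y₁ := 405000 - 2000 * y - 600 * y ^ 2 with hy₁
  have hx3 : quartic a x = x₀ + a * x₁ := by
    rw [hx₀, hx₁, quartic]
    ring
  have hy3 : quartic (-a) y = y₀ - a * y₁ := by
    rw [hy₀, hy₁, quartic]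
    ring
  rw [dodecic, hx3] at hx
  rw [dodecic, hy3] at hy
  clear_value x₀ x₁ y₀ y₁
  have cx : (x₀ + a * x₁) ^ 3 = x₀ ^ 3 - 15 * x₀ * x₁ ^ 2 + a * (3 * x₀ ^ 2 * x₁ - 5 * x₁ ^ 3) := by
    linear_combination (3 * x₀ * x₁ ^ 2 + a * x₁ ^ 3) * ha
  have cy : (y₀ - a * y₁) ^ 3 = y₀ ^ 3 - 15 * y₀ * y₁ ^ 2 - a * (3 * y₀ ^ 2 * y₁ - 5 * y₁ ^ 3) := by
    linear_combination (3 * y₀ * y₁ ^ 2 - a * y₁ ^ 3) * ha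
  rw [cx] at hx
  rw [cy] at hy
  generalize x₀ ^ 3 - 15 * x₀ * x₁ ^ 2 = A₀, 3 * x₀ ^ 2 * x₁ - 5 * x₁ ^ 3 = A₁,
    y₀ ^ 3 - 15 * y₀ * y₁ ^ 2 = B₀, 3 * y₀ ^ 2 * y₁ - 5 * y₁ ^ 3 = B₁ at *
  have hc : (118 * a - 475) * (-118 * a - 475) = 295245 := by
    linear_combination -13924 * ha
  have hc' : (118 * a - 475) ^ 2 = 156005 - 112100 * a := by
    linear_combination 13924 * ha
  have hxy : (118 * a - 475) * (-118 * a - 475) * (A₀ + a * A₁) * y ^ 2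
      = (118 * a - 475) ^ 2 * (B₀ - a * B₁) * x ^ 2 := by
    linear_combination y ^ 2 * (118 * a - 475) * (-118 * a - 475) * hx
      - x ^ 2 * (118 * a - 475) ^ 2 * hy
  rw [hc, hc'] at hxy
  rw [num, den]
  generalize numRe x y = u₀, numIm x y = u₁, denRe x y = v₀, denIm x y = v₁ at *
  linear_combination e0 + a * e1 + hxy +
    (5 * u₁ ^ 2 - 15 * x * y * v₁ ^ 2 + 112100 * B₁ * x ^ 2) * ha

end Correspondence

section Hadamard

/-- A Hadamard matrix of order 12; `true` stands for `-1`. -/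
def hadamard (i j : Fin 12) : Bool :=
  Nat.testBit (![0, 3780, 934, 222, 1596, 2968, 3342, 2420, 1512, 1874, 3250, 2666] i) j

theorem hadamard_signs (e₁ e₂ e₃ e₄ : Bool)
    (h : ∀ j, ∃ k, hadamard 1 j = (e₁ ^^ hadamard 1 k) ∧ hadamard 2 j = (e₂ ^^ hadamard 2 k) ∧
      hadamard 3 j = (e₃ ^^ hadamard 3 k) ∧ hadamard 4 j = (e₄ ^^ hadamard 4 k)) :
    e₁ = false ∧ e₂ = false ∧ e₃ = false ∧ e₄ = false := by
  revert e₁ e₂ e₃ e₄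
  decide +kernel

theorem eq_or_of_hadamard_eq (j k : Fin 12) (h₁ : hadamard 1 j = hadamard 1 k)
    (h₂ : hadamard 2 j = hadamard 2 k) (h₃ : hadamard 3 j = hadamard 3 k)
    (h₄ : hadamard 4 j = hadamard 4 k) : j = k ∨ j = 3 ∧ k = 4 ∨ j = 4 ∧ k = 3 := by
  revert j k
  decide +kernel

theorem exists_hadamard_swap_ne (e : Bool) (k : Fin 12) :
    ∃ j, hadamard 6 j ≠ (e ^^ hadamard k (Equiv.swap 3 4 j)) := by
  revert e k
  decide +kernel

theorem hadamard_zero_left (j : Fin 12) : hadamard 0 j = false := by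
  revert j
  decide +kernel

theorem hadamard_zero_right (i : Fin 12) : hadamard i 0 = false := by
  revert i
  decide +kernel

theorem hadamard_injective (i k : Fin 12) (h : ∀ j, hadamard i j = hadamard k j) : i = k := by
  revert i k
  decide +kernel

/-- A signed automorphism of the Hadamard matrix fixing five rows up to sign is trivial up to
sign. -/
theorem hadamard_rigidity {κ : Bool} {ε δ : Fin 12 → Bool} {π ρ : Fin 12 → Fin 12}
    (hρ : Function.Injective ρ)
    (h : ∀ i j, hadamard i j = (κ ^^ ε i ^^ δ j ^^ hadamard (π i) (ρ j)))
    (h0 : π 0 = 0) (h1 : π 1 = 1) (h2 : π 2 = 2) (h3 : π 3 = 3) (h4 : π 4 = 4) :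
    (∀ i, π i = i ∧ ε i = ε 0) ∧ ∀ j, ρ j = j ∧ δ j = δ 0 := by
  have hδ (j) : δ j = (κ ^^ ε 0) := by
    have := h 0 j
    rw [h0, hadamard_zero_left, hadamard_zero_left] at this
    revert this
    generalize ε 0 = b, δ j = c
    clear h
    revert κ b c
    decide
  have h' (i j) : hadamard i j = ((ε 0 ^^ ε i) ^^ hadamard (π i) (ρ j)) := by
    rw [h, hδ]
    cases κ <;> cases ε 0 <;> cases ε i <;> rfl
  obtain ⟨e1, e2, e3, e4⟩ := hadamard_signs _ _ _ _ fun j =>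
    ⟨ρ j, (h' 1 j).trans (by rw [h1]), (h' 2 j).trans (by rw [h2]), (h' 3 j).trans (by rw [h3]),
      (h' 4 j).trans (by rw [h4])⟩
  have hρ' (j) : j = ρ j ∨ j = 3 ∧ ρ j = 4 ∨ j = 4 ∧ ρ j = 3 := by
    apply eq_or_of_hadamard_eq
    · rw [h', e1, h1, Bool.false_xor]
    · rw [h', e2, h2, Bool.false_xor]
    · rw [h', e3, h3, Bool.false_xor]
    · rw [h', e4, h4, Bool.false_xor]
  have hid (j) : ρ j = j := by
    by_contra hj
    have hswap : ∀ k, ρ k = Equiv.swap 3 4 k := by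
      have h34 : ρ 3 ≠ ρ 4 := hρ.ne (by decide)
      have e3 := hρ' 3
      have e4 := hρ' 4
      have ej := hρ' j
      have h3' : ρ 3 = 4 ∧ ρ 4 = 3 := by
        obtain h | ⟨rfl, h⟩ | ⟨rfl, h⟩ := ej
        · exact absurd h.symm hj
        · refine ⟨h, ?_⟩
          have := e4.resolve_left fun h' => h34 (h.trans h')
          simpa using this
        · refine ⟨?_, h⟩
          have := e3.resolve_left fun h' => h34 (h'.symm.trans h.symm)
          simpa using this
      intro k
      obtain h | ⟨rfl, h⟩ | ⟨rfl, h⟩ := hρ' k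
      · rw [← h, Equiv.swap_apply_of_ne_of_ne]
        · rintro rfl
          rw [h3'.1] at h
          exact absurd h (by decide)
        · rintro rfl
          rw [h3'.2] at h
          exact absurd h (by decide)
      · rw [h, Equiv.swap_apply_left]
      · rw [h, Equiv.swap_apply_right]
    obtain ⟨k, hk⟩ := exists_hadamard_swap_ne (ε 0 ^^ ε 6) (π 6)
    rw [← hswap] at hk
    exact hk (h' 6 k)
  have hε (i) : ε 0 = ε i := by
    have := h' i 0
    rw [hid, hadamard_zero_right, hadamard_zero_right, Bool.xor_false, eq_comm] at this
    simpa using this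
  refine ⟨fun i => ⟨(hadamard_injective _ _ fun j => ?_).symm, (hε i).symm⟩,
    fun j => ⟨hid j, by rw [hδ, hδ]⟩⟩
  rw [h', hid, hε i, Bool.xor_self, Bool.false_xor]

end Hadamard

section UpperBound

/-- The sign `-1` for `true` and `1` for `false`. -/
def sign {R : Type*} [CommRing R] (b : Bool) : R := bif b then -1 else 1

theorem map_sign {R R' F : Type*} [CommRing R] [CommRing R'] [FunLike F R R']
    [RingHomClass F R R'] (f : F) (b : Bool) : f (sign b) = sign b := by
  cases b <;> simp [sign]

theorem sign_xor {R : Type*} [CommRing R] (b c : Bool) :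
    (sign (b ^^ c) : R) = sign b * sign c := by
  cases b <;> cases c <;> simp [sign]

theorem sign_injective {R : Type*} [CommRing R] [IsDomain R] [CharZero R] :
    Function.Injective (sign : Bool → R) := by
  intro b c h
  have h1 : (1 : R) ≠ -1 := by norm_num
  cases b <;> cases c <;> simp_all [sign, eq_comm]

theorem exists_eq_sign_mul {R : Type*} [CommRing R] {x y : R} (h : x = y ∨ x = -y) :
    ∃ b, x = sign b * y := by
  obtain h | h := h
  · exact ⟨false, by simpa [sign] using h⟩
  · exact ⟨true, by simpa [sign] using h⟩

theorem intCast_eq_iff (p : ℕ) [Fact p.Prime] (m n : ℤ) :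
    (m : AlgebraicClosure (ZMod p)) = n ↔ (p : ℤ) ∣ m - n := by
  rw [← intCast_eq_zero_iff, Int.cast_sub, sub_eq_zero]

variable {S : Type*} [CommRing S] [IsDomain S]

/-- The roots and their square roots can be labelled compatibly with a given reduction. -/
theorem Factorization.exists_relabel {a t : S} (F : Factorization a t) {p : ℕ} [Fact p.Prime]
    (ψ : S →+* AlgebraicClosure (ZMod p)) {a₀ t₀ : ℤ} (ha : ψ a = a₀) (ht : ψ t = t₀)
    {z w : Fin 12 → ℤ} (hz : ∀ i, (p : ℤ) ∣ dodecic a₀ t₀ (z i))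
    (hw : ∀ i, (p : ℤ) ∣ w i ^ 2 - 5 * z i) (hinj : ∀ i j, (p : ℤ) ∣ z i - z j → i = j) :
    ∃ F' : Factorization a t, ∀ i, ψ (F'.z i) = z i ∧ ψ (F'.w i) = w i := by
  have h1 (i) : ∃ j, ψ (F.z j) = z i := by
    apply F.exists_z_of_map
    rw [ha, ht]
    have := map_dodecic (Int.castRingHom (AlgebraicClosure (ZMod p))) a₀ t₀ (z i)
    simp only [eq_intCast] at this
    rw [← this, intCast_eq_zero_iff]
    exact hz i
  choose e he using h1
  have hinj' : Function.Injective e := fun i j h => hinj i j (by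
    rw [← intCast_eq_iff, ← he, h, he])
  have h2 (i) : ∃ x : S, x ^ 2 = 5 * F.z (e i) ∧ ψ x = w i := by
    have h3 : ψ (F.w (e i)) ^ 2 = (w i : AlgebraicClosure (ZMod p)) ^ 2 := by
      have h4 := (intCast_eq_iff p _ _).2 (hw i)
      push_cast at h4
      rw [h4, ← map_pow, F.w_sq, map_mul, map_ofNat, he]
    obtain h4 | h4 := sq_eq_sq_iff_eq_or_eq_neg.1 h3
    · exact ⟨_, F.w_sq _, h4⟩
    · exact ⟨-F.w (e i), by rw [neg_sq, F.w_sq], by rw [map_neg, h4, neg_neg]⟩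
  choose w' hw' hw'' using h2
  refine ⟨⟨fun i => F.z (e i), w', ?_, hw'⟩, fun i => ⟨he i, hw'' i⟩⟩
  rw [F.dodecic_eq]
  exact (Equiv.prod_comp (Equiv.ofBijective e (Finite.injective_iff_bijective.1 hinj'))
    fun i => X - C (F.z i)).symm

/-- The roots of `dodecic 234 2765` modulo 7823. -/
def rootMod : Fin 12 → ℤ :=
  ![664, 824, 1193, 1255, 3547, 3683, 4124, 5007, 5293, 6335, 6602, 7511]

/-- Square roots of `5 * rootMod i` modulo 7823. -/
def sqrtMod : Fin 12 → ℤ :=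
  ![241, 4551, 1764, 6691, 5656, 1908, 7123, 4549, 358, 294, 802, 4854]

/-- The roots of `dodecic (-234) 2765` modulo 7823. -/
def rootMod' : Fin 12 → ℤ :=
  ![185, 1333, 2083, 2474, 3017, 3279, 3358, 4953, 5481, 6054, 6284, 7537]

/-- Square roots of `5 * rootMod' i` modulo 7823. -/
def sqrtMod' : Fin 12 → ℤ :=
  ![6938, 1461, 4928, 4520, 1083, 7644, 4896, 7787, 3867, 7156, 4572, 6070]

theorem num_rootMod (i j : Fin 12) : ¬ (7823 : ℤ) ∣ 5 * num 234 (rootMod i) (rootMod' j) := by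
  revert i j
  decide +kernel

theorem den_rootMod (i j : Fin 12) : (7823 : ℤ) ∣
    451 * sqrtMod i * sqrtMod' j * den 234 (rootMod i) (rootMod' j)
      - sign (hadamard i j) * (5 * num 234 (rootMod i) (rootMod' j)) := by
  revert i j
  decide +kernel

variable {a t : S} 

/-- A choice of `√3` and compatible labellings of the two sets of roots. -/
theorem exists_hadamard [IsIntegrallyClosed S] (ha : a ^ 2 = -5)
    (F : Factorization a t) (F' : Factorization (-a) t) [Fact (Nat.Prime 7823)]
    (ψ : S →+* AlgebraicClosure (ZMod 7823)) (hψa : ψ a = 234) (hψt : ψ t = 2765) :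
    ∃ (F : Factorization a t) (F' : Factorization (-a) t) (s : S), s ^ 2 = 3 ∧ ∀ i j,
      s * F.w i * F'.w j * den a (F.z i) (F'.z j) =
        sign (hadamard i j) * (5 * num a (F.z i) (F'.z j)) ∧
      num a (F.z i) (F'.z j) ≠ 0 := by
  obtain ⟨F, hF⟩ := F.exists_relabel ψ (a₀ := 234) (t₀ := 2765) (by simpa using hψa)
    (by simpa using hψt) (z := rootMod) (w := sqrtMod) (by decide +kernel) (by decide +kernel)
    (by decide +kernel)
  obtain ⟨F', hF'⟩ := F'.exists_relabel ψ (a₀ := -234) (t₀ := 2765) (by simpa using hψa)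
    (by simpa using hψt) (z := rootMod') (w := sqrtMod') (by decide +kernel) (by decide +kernel)
    (by decide +kernel)
  have hnum (i j) : ψ (5 * num a (F.z i) (F'.z j)) =
      ((5 * num 234 (rootMod i) (rootMod' j) : ℤ) : AlgebraicClosure (ZMod 7823)) := by
    have := map_num (Int.castRingHom (AlgebraicClosure (ZMod 7823))) 234 (rootMod i) (rootMod' j)
    simp only [eq_intCast] at this
    rw [map_mul, map_num, hψa, (hF i).1, (hF' j).1, Int.cast_mul, this,
      map_ofNat]
    simp
  have hden (i j) : ψ (den a (F.z i) (F'.z j)) =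
      ((den 234 (rootMod i) (rootMod' j) : ℤ) : AlgebraicClosure (ZMod 7823)) := by
    have := map_den (Int.castRingHom (AlgebraicClosure (ZMod 7823))) 234 (rootMod i) (rootMod' j)
    simp only [eq_intCast] at this
    rw [map_den, hψa, (hF i).1, (hF' j).1, this]
    simp
  have hnum0 (i j) : ψ (5 * num a (F.z i) (F'.z j)) ≠ 0 := by
    rw [hnum, Ne, intCast_eq_zero_iff]
    exact num_rootMod i j
  have hsq (i j) : (5 * num a (F.z i) (F'.z j)) ^ 2 =
      3 * (F.w i * F'.w j * den a (F.z i) (F'.z j)) ^ 2 := by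
    have := num_sq ha (F.dodecic_z i) (F'.dodecic_z j)
    rw [mul_pow, mul_pow, mul_pow, F.w_sq, F'.w_sq]
    linear_combination 5 * this
  have hψ (i j) : 451 * ψ (F.w i * F'.w j * den a (F.z i) (F'.z j)) =
      sign (hadamard i j) * ψ (5 * num a (F.z i) (F'.z j)) := by
    have := (intCast_eq_iff 7823 _ _).2 (den_rootMod i j)
    rw [hnum, map_mul, map_mul, hden, (hF i).2, (hF' j).2, ← mul_assoc, ← mul_assoc]
    have h := map_sign (Int.castRingHom (AlgebraicClosure (ZMod 7823))) (hadamard i j)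
    rw [eq_intCast] at h
    rw [Int.cast_mul (sign _), h] at this
    rw [← this]
    push_cast
    rfl
  have hsign0 (b : Bool) : (sign b : AlgebraicClosure (ZMod 7823)) ≠ 0 := by
    cases b <;> simp [sign]
  obtain ⟨s, hs, hψs⟩ : ∃ s : S, s ^ 2 = 3 ∧ ψ s = 451 := by
    have hd : F.w 0 * F'.w 0 * den a (F.z 0) (F'.z 0) ≠ 0 := by
      intro h
      have := hψ 0 0
      rw [h, map_zero, mul_zero, zero_eq_mul] at this
      exact this.elim (hsign0 _) (hnum0 0 0)
    obtain ⟨s, hs⟩ := (IsIntegrallyClosed.pow_dvd_pow_iff two_ne_zero).1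
      (Dvd.intro_left _ (hsq 0 0).symm)
    have hs3 : s ^ 2 = 3 := by
      have h := hsq 0 0
      rw [hs, mul_pow, mul_comm] at h
      exact mul_right_cancel₀ (pow_ne_zero 2 hd) h
    have h3 : ψ s ^ 2 = 451 ^ 2 := by
      have h := (intCast_eq_iff 7823 (451 ^ 2) 3).2 (by norm_num)
      rw [← map_pow, hs3, map_ofNat]
      exact_mod_cast h.symm
    obtain h | h := sq_eq_sq_iff_eq_or_eq_neg.1 h3
    · exact ⟨s, hs3, h⟩
    · exact ⟨-s, by rw [neg_sq, hs3], by rw [map_neg, h, neg_neg]⟩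
  have h2 : (2 : AlgebraicClosure (ZMod 7823)) ≠ 0 := by
    have := (intCast_eq_zero_iff 7823 2).not.2 (by norm_num)
    exact_mod_cast this
  refine ⟨F, F', s, hs, fun i j => ⟨?_, fun h => hnum0 i j (by rw [h, mul_zero, map_zero])⟩⟩
  have h : (s * F.w i * F'.w j * den a (F.z i) (F'.z j)) ^ 2 =
      (sign (hadamard i j) * (5 * num a (F.z i) (F'.z j))) ^ 2 := by
    rw [mul_pow (sign _), hsq, mul_assoc, mul_assoc, mul_pow s, hs]
    cases hadamard i j <;> simp [sign, mul_assoc]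
  refine (sq_eq_sq_iff_eq_or_eq_neg.1 h).resolve_right fun h' => ?_
  have h'' := congrArg ψ h'
  rw [mul_assoc, mul_assoc, ← mul_assoc (F.w i), map_mul ψ s, hψs, hψ, map_neg,
    map_mul ψ (sign _), map_sign, eq_neg_iff_add_eq_zero, ← two_mul] at h''
  exact mul_ne_zero h2 (mul_ne_zero (hsign0 _) (hnum0 i j)) h''

end UpperBound

section Card

variable {Γ α : Type*} [Group Γ] [Finite Γ]

open MulAction

theorem card_le_mul_of_orbit_subset [MulAction Γ α] {β : Type*} {f : β → α} {B : Finset β}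
    {H : Subgroup Γ} {x : α} (hsub : orbit H x ⊆ f '' B) :
    Nat.card H ≤ B.card * Nat.card (H ⊓ stabilizer Γ x : Subgroup Γ) := by
  rw [card_eq_ncard_orbit_mul H x]
  exact Nat.mul_le_mul_right _ (ncard_orbit_le hsub)

theorem card_le_two_mul {R : Type*} [CommRing R] [MulAction Γ R] {H : Subgroup Γ} {x : R}
    (h : ∀ g ∈ H, g • x = x ∨ g • x = -x) :
    Nat.card H ≤ 2 * Nat.card (H ⊓ stabilizer Γ x : Subgroup Γ) := by
  refine (card_le_mul_of_orbit_subset (x := x) (f := fun b : Bool => sign b * x)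
    (B := Finset.univ) ?_).trans_eq (by simp)
  rintro _ ⟨⟨g, hg⟩, rfl⟩
  obtain ⟨b, hb⟩ := exists_eq_sign_mul (h g hg)
  exact ⟨b, by simp, hb.symm⟩

variable {S : Type*} [CommRing S] [IsDomain S] [Algebra ℤ[X] S] [FaithfulSMul ℤ[X] S]
  [MulSemiringAction Γ S] [SMulCommClass Γ ℤ[X] S] [Algebra.IsInvariant ℤ[X] S Γ] {a s : S}

theorem Factorization.card_le_mul (F : Factorization a (algebraMap ℤ[X] S X)) (ha : a ^ 2 = -5)
    {H : Subgroup Γ} (hH : H ≤ stabilizer Γ a) (T : Finset (Fin 12))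
    (hT : ∀ i ∈ T, H ≤ stabilizer Γ (F.z i)) {j : Fin 12} (hj : j ∉ T) :
    Nat.card H ≤ (12 - T.card) * Nat.card (H ⊓ stabilizer Γ (F.z j) : Subgroup Γ) := by
  refine (card_le_mul_of_orbit_subset (f := F.z) (B := Tᶜ) ?_).trans_eq
    (by rw [Finset.card_compl, Fintype.card_fin])
  rintro _ ⟨⟨g, hg⟩, rfl⟩
  obtain ⟨k, hk⟩ := exists_smul_z (F := F) (hH hg) j
  refine ⟨k, ?_, hk.symm⟩
  rw [Finset.coe_compl]
  rintro hkT
  exact hj (eq_of_smul_z_eq ha hk (hT k hkT hg) ▸ hkT)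

/-- An element fixing `√-5` and five of the roots acts on the square roots of each family of
roots by a sign. -/
theorem smul_w_eq_or_of_hadamard (ha : a ^ 2 = -5) (hs : s ^ 2 = 3)
    {F : Factorization a (algebraMap ℤ[X] S X)} {F' : Factorization (-a) (algebraMap ℤ[X] S X)}
    (h : ∀ i j, s * F.w i * F'.w j * den a (F.z i) (F'.z j) =
        sign (hadamard i j) * (5 * num a (F.z i) (F'.z j)) ∧ num a (F.z i) (F'.z j) ≠ 0)
    {g : Γ} (hg : g • a = a) (h0 : g • F.z 0 = F.z 0) (h1 : g • F.z 1 = F.z 1)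
    (h2 : g • F.z 2 = F.z 2) (h3 : g • F.z 3 = F.z 3) (h4 : g • F.z 4 = F.z 4) :
    ((∀ i, g • F.w i = F.w i) ∨ ∀ i, g • F.w i = -F.w i) ∧
      ((∀ j, g • F'.w j = F'.w j) ∨ ∀ j, g • F'.w j = -F'.w j) := by
  have := charZero_of_faithfulSMul (S := S)
  have ha' : (-a) ^ 2 = -5 := by rw [neg_sq, ha]
  have hg' : g • (-a) = -a := by rw [smul_neg, hg]
  obtain ⟨κ, hκ⟩ : ∃ κ, g • s = sign κ * s := exists_eq_sign_mul (sq_eq_sq_iff_eq_or_eq_neg.1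
    (by rw [← smul_pow', hs, smul_ofNat]))
  choose π hπ using Factorization.exists_smul_z (F := F) hg
  choose ρ hρ using Factorization.exists_smul_z (F := F') hg'
  choose ε hε using fun i => exists_eq_sign_mul (Factorization.smul_w_eq_or (hπ i))
  choose δ hδ using fun j => exists_eq_sign_mul (Factorization.smul_w_eq_or (hρ j))
  have hπk {k} (hk : g • F.z k = F.z k) : π k = k :=
    F.z_injective Γ ha ((hπ k).symm.trans hk)
  have key := hadamard_rigidity (κ := κ) (ε := ε) (δ := δ) (π := π) (ρ := ρ)
    (fun i j hij => eq_of_smul_z_eq ha' (hρ i) (hij ▸ hρ j)) (fun i j => ?_)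
    (hπk h0) (hπk h1) (hπk h2) (hπk h3) (hπk h4)
  · constructor
    · cases h5 : ε 0
      · exact Or.inl fun i => by rw [hε, (key.1 i).1, (key.1 i).2, h5, sign, cond_false, one_mul]
      · exact Or.inr fun i => by
          rw [hε, (key.1 i).1, (key.1 i).2, h5, sign, cond_true, neg_one_mul]
    · cases h5 : δ 0
      · exact Or.inl fun i => by rw [hδ, (key.2 i).1, (key.2 i).2, h5, sign, cond_false, one_mul]
      · exact Or.inr fun i => by
          rw [hδ, (key.2 i).1, (key.2 i).2, h5, sign, cond_true, neg_one_mul]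
  · let f := MulSemiringAction.toRingHom Γ S g
    have hf (x : S) : g • x = f x := rfl
    have h6 := congrArg f (h i j).1
    simp only [map_mul, map_den, map_num, map_sign, map_ofNat] at h6
    simp only [hf] at hg hκ hπ hρ hε hδ
    rw [hg, hκ, hπ, hρ, hε, hδ] at h6
    apply sign_injective (R := S)
    refine mul_right_cancel₀ (mul_ne_zero (OfNat.ofNat_ne_zero 5) (h (π i) (ρ j)).2) ?_
    rw [← h6, sign_xor, sign_xor, sign_xor, mul_assoc _ (sign (hadamard _ _)),
      ← (h (π i) (ρ j)).1]
    ring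

variable (Γ) in
theorem card_eq [IsIntegrallyClosed S] (ha : a ^ 2 = -5)
    (F : Factorization a (algebraMap ℤ[X] S X)) (F' : Factorization (-a) (algebraMap ℤ[X] S X))
    (hΓ : ∀ g : Γ, g • a = a →
      (∀ z w : S, dodecic a (algebraMap ℤ[X] S X) z = 0 → w ^ 2 = 5 * z → g • w = w) →
      (∀ z w : S, dodecic (-a) (algebraMap ℤ[X] S X) z = 0 → w ^ 2 = 5 * z → g • w = w) →
      g = 1) : Nat.card Γ = 760320 := by
  have : Fact (Nat.Prime 7823) := ⟨by norm_num⟩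
  obtain ⟨ψ, g, hψ⟩ := exists_isSpecialization Γ ha 7823 234 2765 (by norm_num)
  obtain ⟨F, F', s, hs, h⟩ := exists_hadamard ha F F' ψ (by simpa using hψ.map_a)
    (by simpa using hψ.map_t)
  refine le_antisymm ?_ (le_card Γ F ha hs)
  have hsmul {b : S} (G : Factorization b (algebraMap ℤ[X] S X)) {g : Γ}
      (hg : ∀ i, g • G.w i = G.w i) (z w : S) (hz : dodecic b (algebraMap ℤ[X] S X) z = 0)
      (hw : w ^ 2 = 5 * z) : g • w = w := by
    obtain ⟨i, rfl⟩ := G.exists_z hz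
    rw [← G.w_sq] at hw
    obtain rfl | rfl := sq_eq_sq_iff_eq_or_eq_neg.1 hw
    · exact hg i
    · rw [smul_neg, hg]
  have hor {x y : S} (hxy : x ^ 2 = y ^ 2) : x = y ∨ x = -y := sq_eq_sq_iff_eq_or_eq_neg.1 hxy
  let H : Subgroup Γ := ⊤ ⊓ stabilizer Γ a
  let H₀ := H ⊓ stabilizer Γ (F.z 0)
  let H₁ := H₀ ⊓ stabilizer Γ (F.z 1)
  let H₂ := H₁ ⊓ stabilizer Γ (F.z 2)
  let H₃ := H₂ ⊓ stabilizer Γ (F.z 3)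
  let H₄ := H₃ ⊓ stabilizer Γ (F.z 4)
  let H₅ := H₄ ⊓ stabilizer Γ (F.w 0)
  have hH₄ {g : Γ} (hg : g ∈ H₄) := by
    obtain ⟨⟨⟨⟨⟨⟨-, hga⟩, h0⟩, h1⟩, h2⟩, h3⟩, h4⟩ := hg
    exact smul_w_eq_or_of_hadamard ha hs h hga h0 h1 h2 h3 h4
  have hle₀ : H₀ ≤ H := inf_le_left
  have hle₁ : H₁ ≤ H₀ := inf_le_left
  have hle₂ : H₂ ≤ H₁ := inf_le_left
  have hle₃ : H₃ ≤ H₂ := inf_le_left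
  have hle₄ : H₄ ≤ H₃ := inf_le_left
  have hHa : H ≤ stabilizer Γ a := inf_le_right
  have e0 : H₀ ≤ stabilizer Γ (F.z 0) := inf_le_right
  have e1 : H₁ ≤ stabilizer Γ (F.z 1) := inf_le_right
  have e2 : H₂ ≤ stabilizer Γ (F.z 2) := inf_le_right
  have e3 : H₃ ≤ stabilizer Γ (F.z 3) := inf_le_right
  have c : Nat.card (⊤ : Subgroup Γ) ≤ 2 * Nat.card H := card_le_two_mul fun g _ => hor (by
    rw [← smul_pow', ha, smul_neg, smul_ofNat])
  have c0 : Nat.card H ≤ 12 * Nat.card H₀ := F.card_le_mul ha hHa ∅ (by simp) (by simp)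
  have c1 : Nat.card H₀ ≤ 11 * Nat.card H₁ :=
    F.card_le_mul ha (hle₀.trans hHa) {0} (by simpa) (by simp)
  have c2 : Nat.card H₁ ≤ 10 * Nat.card H₂ :=
    F.card_le_mul ha ((hle₁.trans hle₀).trans hHa) {0, 1}
      (by simpa using ⟨hle₁.trans e0, e1⟩) (by decide)
  have c3 : Nat.card H₂ ≤ 9 * Nat.card H₃ :=
    F.card_le_mul ha ((hle₂.trans (hle₁.trans hle₀)).trans hHa) {0, 1, 2}
      (by simpa using ⟨hle₂.trans (hle₁.trans e0), hle₂.trans e1, e2⟩) (by decide)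
  have c4 : Nat.card H₃ ≤ 8 * Nat.card H₄ :=
    F.card_le_mul ha ((hle₃.trans (hle₂.trans (hle₁.trans hle₀))).trans hHa) {0, 1, 2, 3}
      (by simpa using ⟨hle₃.trans (hle₂.trans (hle₁.trans e0)), hle₃.trans (hle₂.trans e1),
        hle₃.trans e2, e3⟩) (by decide)
  have c5 : Nat.card H₄ ≤ 2 * Nat.card H₅ :=
    card_le_two_mul fun g hg => (hH₄ hg).1.imp (· 0) (· 0)
  have c6 : Nat.card H₅ ≤ 2 * Nat.card (H₅ ⊓ stabilizer Γ (F'.w 0) : Subgroup Γ) :=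
    card_le_two_mul fun g hg => (hH₄ hg.1).2.imp (· 0) (· 0)
  have hCZ := charZero_of_faithfulSMul (S := S)
  have hbot : (H₅ ⊓ stabilizer Γ (F'.w 0) : Subgroup Γ) = ⊥ := by
    refine (Subgroup.eq_bot_iff_forall _).2 ?_
    rintro g ⟨⟨hg, hw⟩, hw'⟩
    have ha' : (-a) ^ 2 = -5 := by rw [neg_sq, ha]
    change g • _ = _ at hw hw'
    refine hΓ g ((hle₄.trans (hle₃.trans (hle₂.trans (hle₁.trans hle₀)))).trans hHa hg)
      (hsmul F ((hH₄ hg).1.resolve_right fun h' => ?_))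
      (hsmul F' ((hH₄ hg).2.resolve_right fun h' => ?_))
    · exact F.w_ne_zero ha 0 (self_eq_neg.1 (hw.symm.trans (h' 0)))
    · exact F'.w_ne_zero ha' 0 (self_eq_neg.1 (hw'.symm.trans (h' 0)))
  rw [hbot, Subgroup.card_bot] at c6
  rw [Subgroup.card_top] at c
  omega

end Card

section Norm

variable {R : Type*} [CommRing R]

/-- The polynomial `f_A(t, x)`, with `a` in the role of `√-5`. -/
def form (a t x : R) : R :=
  5 ^ 3 * (24 * a * x ^ 2 + 16 * a * x - 648 * a - x ^ 4 - 60 * x ^ 3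
      - 870 * x ^ 2 - 220 * x + 6399) ^ 3
    - 2 ^ 12 * 3 ^ 15 * (118 * a - 475) * t * x ^ 2

/-- The product of `form a t x` and `form (-a) t x` for `a ^ 2 = -5`. -/
def normForm (t x : R) : R :=
  let u := 6399 - x ^ 4 - 60 * x ^ 3 - 870 * x ^ 2 - 220 * x
  let v := 24 * x ^ 2 + 16 * x - 648
  let c := 2 ^ 12 * 3 ^ 15 * t * x ^ 2
  (125 * (u ^ 3 - 15 * u * v ^ 2) + 475 * c) ^ 2
    + 5 * (125 * (3 * u ^ 2 * v - 5 * v ^ 3) - 118 * c) ^ 2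

section
variable {R' F : Type*} [CommRing R'] [FunLike F R R'] [RingHomClass F R R'] (f : F)

theorem map_form (a t x : R) : f (form a t x) = form (f a) (f t) (f x) := by
  simp only [form, map_add, map_sub, map_mul, map_pow, map_ofNat]

theorem map_normForm (t x : R) : f (normForm t x) = normForm (f t) (f x) := by
  simp only [normForm, map_add, map_sub, map_mul, map_pow, map_ofNat]

end

variable {a : R}

theorem form_mul_form_neg (ha : a ^ 2 = -5) (t x : R) :
    form a t x * form (-a) t x = normForm t x := by
  let u := 6399 - x ^ 4 - 60 * x ^ 3 - 870 * x ^ 2 - 220 * x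
  let v := 24 * x ^ 2 + 16 * x - 648
  let c := 2 ^ 12 * 3 ^ 15 * t * x ^ 2
  have key (b : R) (hb : b ^ 2 = -5) : form b t x =
      (125 * (u ^ 3 - 15 * u * v ^ 2) + 475 * c)
        + b * (125 * (3 * u ^ 2 * v - 5 * v ^ 3) - 118 * c) := by
    have : form b t x = 125 * (u + b * v) ^ 3 - (118 * b - 475) * c := by
      simp only [form, u, v, c]
      ring
    linear_combination this + 125 * (3 * u * v ^ 2 + b * v ^ 3) * hb
  rw [key a ha, key (-a) (by rw [neg_sq, ha])]
  change _ = (125 * (u ^ 3 - 15 * u * v ^ 2) + 475 * c) ^ 2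
    + 5 * (125 * (3 * u ^ 2 * v - 5 * v ^ 3) - 118 * c) ^ 2
  linear_combination (-(125 * (3 * u ^ 2 * v - 5 * v ^ 3) - 118 * c) ^ 2) * ha

theorem dodecic_five_mul (a t x : R) : dodecic a t (5 * x) = -5 ^ 9 * form a t x := by
  simp only [dodecic, quartic, form]
  ring

theorem dodecic_mul_dodecic_neg (ha : a ^ 2 = -5) (t x : R) :
    dodecic a t (5 * x) * dodecic (-a) t (5 * x) = 5 ^ 18 * normForm t x := by
  rw [dodecic_five_mul, dodecic_five_mul, ← form_mul_form_neg ha]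
  ring

end Norm

section Factorization

theorem dodecic_isMonicOfDegree {R : Type*} [CommRing R] [Nontrivial R] (a t : R) :
    IsMonicOfDegree (dodecic (C a) (C t) (X : R[X])) 12 := by
  have h : (quartic (C a) (X : R[X])).natDegree = 4 ∧ (quartic (C a) (X : R[X])).Monic := by
    have : quartic (C a) (X : R[X]) = X ^ 4 + (C 300 * X ^ 3 + C (25 * (870 - 24 * a)) * X ^ 2
        + C (125 * (220 - 16 * a)) * X - C (625 * (6399 - 648 * a))) := by
      simp only [quartic, C_mul, C_sub, C_ofNat]
      ring
    rw [this]
    exact ⟨by compute_degree!, by monicity!⟩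
  have h3 : IsMonicOfDegree (quartic (C a) (X : R[X]) ^ 3) 12 := by
    simpa using (IsMonicOfDegree.mk h.1 h.2).pow 3
  refine h3.add_right ?_
  have : (5 ^ 7 * 2 ^ 12 * 3 ^ 15 * (118 * C a - 475) * C t * X ^ 2 : R[X]) =
      C (5 ^ 7 * 2 ^ 12 * 3 ^ 15 * (118 * a - 475) * t) * X ^ 2 := by
    simp only [C_mul, C_sub, C_ofNat, C_pow]
  rw [this]
  exact (natDegree_C_mul_X_pow_le _ _).trans_lt (by norm_num)

theorem exists_factorization {L : Type*} [Field L] [IsAlgClosed L] (a t : L) :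
    Nonempty (Factorization a t) := by
  have h := dodecic_isMonicOfDegree a t
  have hs := IsAlgClosed.splits (dodecic (C a) (C t) (X : L[X]))
  have hc := hs.natDegree_eq_card_roots
  obtain ⟨l, hl⟩ := Quot.exists_rep (dodecic (C a) (C t) (X : L[X])).roots
  have hl' : l.length = 12 := by
    rw [← Multiset.coe_card, ← h.natDegree_eq, hc]
    exact congrArg _ hl
  choose w hw using fun z : L => IsAlgClosed.exists_pow_nat_eq (5 * z) two_pos
  refine ⟨⟨fun i => l.get (i.cast hl'.symm), fun i => w (l.get (i.cast hl'.symm)), ?_,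
    fun i => hw _⟩⟩
  rw [hs.eq_prod_roots_of_monic h.monic, ← hl]
  change (Multiset.map _ (l : Multiset L)).prod = _
  rw [Multiset.map_coe, Multiset.prod_coe, ← Fin.prod_univ_fun_getElem]
  exact Fintype.prod_equiv (finCongr hl') _ _ fun _ => rfl

/-- A factorization descends to a subring containing the chosen elements. -/
noncomputable def Factorization.ofInjective {S R : Type*} [CommRing S] [CommRing R] {f : S →+* R}
    (hf : Function.Injective f) {a t : S} (F : Factorization (f a) (f t))
    (hz : ∀ i, F.z i ∈ f.range) (hw : ∀ i, F.w i ∈ f.range) : Factorization a t where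
  z i := (hz i).choose
  w i := (hw i).choose
  dodecic_eq := by
    apply Polynomial.map_injective f hf
    have := map_dodecic (mapRingHom f) (C a) (C t) X
    rw [coe_mapRingHom] at this
    rw [this, Polynomial.map_prod, Polynomial.map_C, Polynomial.map_C, Polynomial.map_X,
      F.dodecic_eq]
    exact Finset.prod_congr rfl fun i _ => by
      rw [Polynomial.map_sub, Polynomial.map_X, Polynomial.map_C, (hz i).choose_spec]
  w_sq i := hf (by
    rw [map_pow, map_mul, map_ofNat, (hz i).choose_spec, (hw i).choose_spec, F.w_sq])

end Factorization

section Gal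

section Descent

variable {E L : Type*} [Field E] [Field L] [CharZero L] {φ : E →+* L} {t : E} {a : L}

theorem Factorization.w_mem_range (hp : ((normForm (C t) X).comp (X ^ 2)).Splits)
    (ha : a ^ 2 = -5) (G : Factorization a (φ t)) (i : Fin 12) : G.w i ∈ φ.range := by
  have : CharZero E := φ.charZero
  have h : ((normForm (C t) X).comp (X ^ 2) : E[X]) ≠ 0 := fun h => by
    have := congrArg (eval 0) h
    rw [eval_comp, ← coe_evalRingHom, ← coe_evalRingHom, map_normForm] at this
    norm_num [normForm] at this
  have h2 : G.w i / 5 ∈ φ.range := by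
    refine hp.mem_range_of_isRoot h ?_
    have h3 : (normForm (C t) X : E[X]).map φ = normForm (C (φ t)) X := by
      simpa using map_normForm (mapRingHom φ) (C t) X
    rw [IsRoot, Polynomial.map_comp, h3, eval_comp, ← coe_evalRingHom, map_normForm]
    simp only [coe_evalRingHom, eval_C, eval_X, Polynomial.map_pow, map_X, eval_pow]
    have h4 := dodecic_mul_dodecic_neg ha (φ t) (G.z i / 5)
    rw [mul_div_cancel₀ _ (by norm_num : (5 : L) ≠ 0), G.dodecic_z, zero_mul] at h4
    rw [div_pow, G.w_sq, show 5 * G.z i / 5 ^ 2 = G.z i / 5 by ring]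
    exact (mul_eq_zero.1 h4.symm).resolve_left (by norm_num)
  simpa using mul_mem h2 (ofNat_mem φ.range 5)

theorem Factorization.z_mem_range (hp : ((normForm (C t) X).comp (X ^ 2)).Splits)
    (ha : a ^ 2 = -5) (G : Factorization a (φ t)) (i : Fin 12) : G.z i ∈ φ.range := by
  have h := G.w_mem_range hp ha i
  obtain ⟨w, hw⟩ := h
  exact ⟨w ^ 2 / 5, by rw [map_div₀, map_pow, hw, G.w_sq, map_ofNat]; ring⟩

/-- The norm of a root recovers `√-5`. -/
theorem Factorization.mem_range (hp : ((normForm (C t) X).comp (X ^ 2)).Splits)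
    (ha : a ^ 2 = -5) (G : Factorization a (φ t)) : a ∈ φ.range := by
  have h := G.eval_map (RingHom.id L) 0
  have h2 : ∏ i, (0 - G.z i) ∈ φ.range :=
    prod_mem fun i _ => sub_mem (zero_mem _) (G.z_mem_range hp ha i)
  simp only [RingHom.id_apply] at h
  rw [← h] at h2
  obtain ⟨c, hc⟩ := h2
  refine ⟨(c + 625 ^ 3 * (6399 ^ 3 - 15 * 6399 * 648 ^ 2))
    / (625 ^ 3 * (3 * 6399 ^ 2 * 648 - 5 * 648 ^ 3)), ?_⟩
  simp only [map_div₀, map_add, map_mul, map_sub, map_pow, map_ofNat, hc]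
  rw [div_eq_iff (by norm_num)]
  simp only [dodecic, quartic]
  linear_combination (625 ^ 3 * (-3 * 6399 * 648 ^ 2 + 648 ^ 3 * a)) * ha

theorem exists_factorization_of_splits [CharZero E]
    (hp : ((normForm (C t) X).comp (X ^ 2)).Splits) :
    ∃ a : E, a ^ 2 = -5 ∧ Nonempty (Factorization a t) ∧ Nonempty (Factorization (-a) t) := by
  let φ := algebraMap E (AlgebraicClosure E)
  obtain ⟨a, ha⟩ := IsAlgClosed.exists_pow_nat_eq (-5 : AlgebraicClosure E) two_pos
  obtain ⟨G⟩ := exists_factorization a (φ t)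
  have ha' : (-a) ^ 2 = -5 := by rw [neg_sq, ha]
  obtain ⟨a, rfl⟩ := G.mem_range hp ha
  rw [← map_neg] at ha'
  obtain ⟨G'⟩ := exists_factorization (φ (-a)) (φ t)
  exact ⟨a, φ.injective (by rw [map_pow, map_neg, map_ofNat, ha]),
    ⟨G.ofInjective φ.injective (G.z_mem_range hp ha) (G.w_mem_range hp ha)⟩,
    ⟨G'.ofInjective φ.injective (G'.z_mem_range hp ha') (G'.w_mem_range hp ha')⟩⟩

end Descent

section Integral

variable {R E : Type*} [CommRing R] [Field E] [Algebra R E]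

theorem Factorization.exists_integralClosure {a t : integralClosure R E}
    (G : Factorization (a : E) (t : E)) : Nonempty (Factorization a t) := by
  have hz (i : Fin 12) : IsIntegral R (G.z i) := by
    refine isIntegral_trans (A := integralClosure R E) _ ⟨dodecic (C a) (C t) X,
      (dodecic_isMonicOfDegree a t).monic, ?_⟩
    rw [← coe_eval₂RingHom, map_dodecic]
    simpa using G.dodecic_z i
  have hw (i : Fin 12) : IsIntegral R (G.w i) := by
    refine IsIntegral.of_pow two_pos ?_
    rw [G.w_sq]
    exact (map_ofNat (algebraMap R E) 5 ▸ isIntegral_algebraMap).mul (hz i)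
  refine ⟨Factorization.ofInjective (f := (integralClosure R E).val.toRingHom)
    Subtype.val_injective G (fun i => ⟨⟨_, hz i⟩, rfl⟩) fun i => ⟨⟨_, hw i⟩, rfl⟩⟩

end Integral

theorem card_gal {F E : Type*} [Field F] [Algebra ℤ[X] F] [IsFractionRing ℤ[X] F]
    [Field E] [Algebra F E] [Algebra ℤ[X] E] [IsScalarTower ℤ[X] F E]
    [hE : IsSplittingField F E ((normForm (C (algebraMap ℤ[X] F X)) X).comp (X ^ 2))] :
    Nat.card Gal(E/F) = 760320 := by
  set p := (normForm (C (algebraMap ℤ[X] F X)) X).comp (X ^ 2) with hpdef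
  have hF := charZero_of_faithfulSMul (S := F)
  have : CharZero E := charZero_of_injective_algebraMap (algebraMap F E).injective
  have : FiniteDimensional F E := IsSplittingField.finiteDimensional E p
  have : IsGalois F E := { to_normal := .of_isSplittingField p }
  have : SMulCommClass Gal(E/F) ℤ[X] E := ⟨fun g r x => by
    rw [← algebraMap_smul F r x, smul_comm, algebraMap_smul]⟩
  let S := integralClosure ℤ[X] E
  have : IsFractionRing S E := integralClosure.isFractionRing_of_finite_extension F E
  have : IsIntegrallyClosed S := integralClosure.isIntegrallyClosedOfFiniteExtension F
  have : IsGaloisGroup Gal(E/F) ℤ[X] S := IsGaloisGroup.of_isFractionRing Gal(E/F) ℤ[X] S F E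
  have : Algebra.IsInvariant ℤ[X] S Gal(E/F) := IsGaloisGroup.isInvariant
  have : FaithfulSMul ℤ[X] E := .trans ℤ[X] F E
  have : FaithfulSMul ℤ[X] S := .tower_bot ℤ[X] S E
  have hmap (y : E) : aeval y p = normForm (algebraMap ℤ[X] E X) (y ^ 2) := by
    rw [hpdef, aeval_comp, map_normForm]
    simp [← IsScalarTower.algebraMap_apply]
  have hsplit : ((normForm (C (algebraMap ℤ[X] E X)) X).comp (X ^ 2)).Splits := by
    convert hE.splits
    rw [hpdef, Polynomial.map_comp, ← coe_mapRingHom, map_normForm]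
    simp [← IsScalarTower.algebraMap_apply]
  obtain ⟨a, ha, ⟨G⟩, ⟨G'⟩⟩ := exists_factorization_of_splits hsplit
  have hai : IsIntegral ℤ[X] a := by
    refine IsIntegral.of_pow two_pos ?_
    rw [ha]
    exact (map_ofNat (algebraMap ℤ[X] E) 5 ▸ isIntegral_algebraMap).neg
  lift a to S using hai
  obtain ⟨G⟩ := Factorization.exists_integralClosure (t := algebraMap ℤ[X] S X) G
  obtain ⟨G'⟩ := Factorization.exists_integralClosure (a := -a) (t := algebraMap ℤ[X] S X) G'
  have ha' : a ^ 2 = -5 := Subtype.ext ha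
  refine card_eq Gal(E/F) ha' G G' fun g _ h h' => ?_
  have key {b : S} (H : Factorization b (algebraMap ℤ[X] S X))
      (hg : ∀ z w : S, dodecic b (algebraMap ℤ[X] S X) z = 0 → w ^ 2 = 5 * z → g • w = w)
      {y : E} (hy : dodecic (b : E) (algebraMap ℤ[X] E X) (5 * y ^ 2) = 0) : g y = y := by
    obtain ⟨i, hi⟩ := H.exists_z_of_map (algebraMap S E) hy
    have hw : g (H.w i) = H.w i := congrArg Subtype.val (hg _ _ (H.dodecic_z i) (H.w_sq i))
    have hw2 : (H.w i : E) ^ 2 = 5 * H.z i := congrArg Subtype.val (H.w_sq i)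
    change (H.z i : E) = _ at hi
    have h5 : (5 * y) ^ 2 = (H.w i : E) ^ 2 := by rw [hw2, hi]; ring
    have h50 : (5 : E) ≠ 0 := by norm_num
    refine mul_left_cancel₀ h50 ?_
    have : g (5 * y) = 5 * y := by
      obtain h5 | h5 := sq_eq_sq_iff_eq_or_eq_neg.1 h5 <;> simp [h5, hw]
    rwa [map_mul, map_ofNat] at this
  have hroot (y : E) (hy : y ∈ p.rootSet E) : g y = y := by
    have h0 := dodecic_mul_dodecic_neg ha (algebraMap ℤ[X] E X) (y ^ 2)
    rw [← hmap, aeval_eq_zero_of_mem_rootSet hy, mul_zero] at h0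
    exact (mul_eq_zero.1 h0).elim (key G h) (key G' h')
  refine AlgEquiv.ext fun y => ?_
  exact DFunLike.congr_fun (AlgHom.ext_of_adjoin_eq_top (φ₁ := (g : E →ₐ[F] E))
    (φ₂ := AlgHom.id F E) (IsSplittingField.adjoin_rootSet E p) hroot) y

end Gal

section RatFunc

attribute [local instance] Polynomial.algebra

theorem isFractionRing_ratFunc : IsFractionRing ℤ[X] (RatFunc ℚ) := by
  have h : Function.Injective (algebraMap ℤ[X] (RatFunc ℚ)) :=
    (RatFunc.algebraMap_injective ℚ).comp
      (Polynomial.map_injective (algebraMap ℤ ℚ) Int.cast_injective)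
  have : FaithfulSMul ℤ[X] (RatFunc ℚ) := (faithfulSMul_iff_algebraMap_injective _ _).2 h
  have key (q : ℚ[X]) : ∃ n : ℤ, n ≠ 0 ∧ ∃ r : ℤ[X],
      algebraMap ℤ[X] (RatFunc ℚ) r = n * algebraMap ℚ[X] (RatFunc ℚ) q := by
    obtain ⟨n, hn, hq⟩ := IsLocalization.integerNormalization_spec (nonZeroDivisors ℤ) q
    refine ⟨n, nonZeroDivisors.ne_zero hn, _, (congrArg (algebraMap ℚ[X] (RatFunc ℚ)) hq).trans ?_⟩
    rw [zsmul_eq_mul, map_mul, map_intCast]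
  refine IsFractionRing.of_field _ _ fun z => ?_
  obtain ⟨n, hn, r, hr⟩ := key z.num
  obtain ⟨m, hm, s, hs⟩ := key z.denom
  have hn' : (n : RatFunc ℚ) ≠ 0 := Int.cast_ne_zero.2 hn
  have hm' : (m : RatFunc ℚ) ≠ 0 := Int.cast_ne_zero.2 hm
  refine ⟨m * r, n * s, ?_⟩
  rw [map_mul, map_mul, hr, hs, map_intCast, map_intCast, mul_left_comm,
    mul_div_mul_left _ _ hn', mul_div_mul_left _ _ hm', RatFunc.num_div_denom]

theorem ratFunc_mapRingHom_algebraMap {K R : Type*} [Field K] [CommRing R] [IsDomain R]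
    (φ : K[X] →+* R[X]) (hφ : nonZeroDivisors K[X] ≤ (nonZeroDivisors R[X]).comap φ) (p : K[X]) :
    RatFunc.mapRingHom φ hφ (algebraMap K[X] (RatFunc K) p) =
        algebraMap R[X] (RatFunc R) (φ p) := by
  rw [RatFunc.coe_mapRingHom_eq_coe_map]
  simpa using RatFunc.map_apply_div φ hφ p 1

end RatFunc

end M12

/-- With `K = ℚ(√-5)`, `a = √-5`, `σ` the nontrivial automorphism of `K/ℚ`,
and `f_{A2} = f_A · σf_A` (a polynomial with coefficients in `ℚ(t)`), the degree-48 polynomial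
`f_{A2}(t, y²) ∈ ℚ(t)[y]` has Galois group over `ℚ(t)` of order `760320`, the order of a group
of shape `2².M₁₂.2`. -/
theorem galois_group_of_fA2_y_sq_has_card_4_M12_2 (K : Type) [Field K] [Algebra ℚ K]
    (a : K) (ha : a ^ 2 = -5) (hgen : IntermediateField.adjoin ℚ {a} = ⊤)
    (σ : K ≃ₐ[ℚ] K) (hσ : σ a = -a) :
    -- the extension of `σ` to `K(t)` fixing `t`, used to conjugate coefficients
    let sigmaT : RatFunc K →+* RatFunc K :=
      RatFunc.mapRingHom (Polynomial.mapRingHom (σ : K →+* K))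
        (nonZeroDivisors_le_comap_nonZeroDivisors_of_injective _
          (Polynomial.map_injective _ (RingHom.injective _)))
    -- the inclusion `ℚ(t) → K(t)`
    let ι : RatFunc ℚ →+* RatFunc K :=
      RatFunc.mapRingHom (Polynomial.mapRingHom (algebraMap ℚ K))
        (nonZeroDivisors_le_comap_nonZeroDivisors_of_injective _
          (Polynomial.map_injective _ (RingHom.injective _)))
    let A : Polynomial (RatFunc K) := C (RatFunc.C a)
    let t : Polynomial (RatFunc K) := C RatFunc.X
    let fA : Polynomial (RatFunc K) :=
      5 ^ 3 * (24 * A * X ^ 2 + 16 * A * X - 648 * A - X ^ 4 - 60 * X ^ 3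
          - 870 * X ^ 2 - 220 * X + 6399) ^ 3
        - 2 ^ 12 * 3 ^ 15 * (118 * A - 475) * t * X ^ 2
    let fA2 : Polynomial (RatFunc K) := fA * fA.map sigmaT
    -- `g` is the polynomial `f_{A2}` viewed as an element of `ℚ(t)[x]`;
    -- `g.comp (X ^ 2)` is then `f_{A2}(t, y²)`
    ∀ g : Polynomial (RatFunc ℚ), g.map ι = fA2 →
      Nat.card (g.comp (X ^ 2)).Gal = 760320 := by
  intro sigmaT ι A t fA fA2 g hg
  have hA : A ^ 2 = -5 := by
    rw [← C_pow, ← map_pow, ha, map_neg, map_neg, map_ofNat, map_ofNat]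
  have hσA : A.map sigmaT = -A := by
    have : sigmaT (RatFunc.C a) = -RatFunc.C a := by
      rw [← RatFunc.algebraMap_C]
      refine (M12.ratFunc_mapRingHom_algebraMap _ _ _).trans ?_
      rw [coe_mapRingHom, Polynomial.map_C, ← map_neg, ← C_neg]
      exact congrArg (fun x => algebraMap K[X] (RatFunc K) (C x)) hσ
    rw [Polynomial.map_C, this, C_neg]
  have hσt : t.map sigmaT = t := by
    have : sigmaT RatFunc.X = RatFunc.X := by
      rw [← RatFunc.algebraMap_X]
      refine (M12.ratFunc_mapRingHom_algebraMap _ _ _).trans ?_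
      rw [coe_mapRingHom, Polynomial.map_X]
    rw [Polynomial.map_C, this]
  have hιt : (C RatFunc.X : (RatFunc ℚ)[X]).map ι = t := by
    have : ι RatFunc.X = RatFunc.X := by
      rw [← RatFunc.algebraMap_X]
      refine (M12.ratFunc_mapRingHom_algebraMap _ _ _).trans ?_
      rw [coe_mapRingHom, Polynomial.map_X, RatFunc.algebraMap_X]
    rw [Polynomial.map_C, this]
  have hfA : fA.map sigmaT = M12.form (-A) t X := by
    have := M12.map_form (mapRingHom sigmaT) A t X
    rw [coe_mapRingHom, hσA, hσt, Polynomial.map_X] at this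
    exact this
  obtain rfl : g = M12.normForm (C RatFunc.X) X := by
    apply Polynomial.map_injective ι ι.injective
    have := M12.map_normForm (mapRingHom ι) (C RatFunc.X) X
    rw [coe_mapRingHom, hιt, Polynomial.map_X, ← M12.form_mul_form_neg hA, ← hfA] at this
    exact hg.trans this.symm
  let _ : Algebra ℤ[X] ℚ[X] := Polynomial.algebra ..
  have := M12.isFractionRing_ratFunc
  have hX : algebraMap ℤ[X] (RatFunc ℚ) X = RatFunc.X := by
    rw [IsScalarTower.algebraMap_apply ℤ[X] ℚ[X] (RatFunc ℚ), ← RatFunc.algebraMap_X]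
    congr 1
    exact Polynomial.map_X _
  rw [← hX]
  exact M12.card_gal
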